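/- arXiv:0810.0653 — 2 statements merged into one kernel-verified Lean document; each statement's English description precedes it below -/
import Mathlib

section
/- Let J be a real-analytic almost complex structure on ℝ⁴ and let M = {ρ = 0} be a real-analytic hypersurface in an open set Ω ⊆ ℝ⁴. Then the type function z ↦ δ_M(z), with values in ℕ ∪ {∞}, is upper semicontinuous on M: for every p ∈ M there is a neighborhood U of p in M such that δ_M(z) ≤ δ_M(p) for all z ∈ U. -/
noncomputable section

open Set

abbrev E4 : Type := EuclideanSpace ℝ (Fin 4)
abbrev E2 : Type := ℝ × ℝ

/-- The standard complex structure `J₀` on `ℝ²`: `J₀(x,y) = (-y,x)`. -/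
def J0 : E2 →L[ℝ] E2 :=
  (-(ContinuousLinearMap.snd ℝ ℝ ℝ)).prod (ContinuousLinearMap.fst ℝ ℝ ℝ)

/-- A real-analytic almost complex structure on `ℝ⁴`. -/
def IsAlmostComplex (J : E4 → E4 →L[ℝ] E4) : Prop :=
  (∀ p, AnalyticAt ℝ J p) ∧ ∀ p, (J p).comp (J p) = - ContinuousLinearMap.id ℝ E4

/-- A `J`-holomorphic disk: a smooth map on an open neighborhood `V` of `0` in `ℝ²`
satisfying `du ∘ J₀ = J(u) ∘ du` on `V`. -/
def IsJHolDisk (J : E4 → E4 →L[ℝ] E4) (V : Set E2) (u : E2 → E4) : Prop :=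
  IsOpen V ∧ (0 : E2) ∈ V ∧ ContDiffOn ℝ (⊤ : ℕ∞) u V ∧
    ∀ z ∈ V, (fderiv ℝ u z).comp J0 = (J (u z)).comp (fderiv ℝ u z)

/-- `u` is regular on `V` if its differential does not vanish on `V`. -/
def IsRegularOn (u : E2 → E4) (V : Set E2) : Prop := ∀ z ∈ V, fderiv ℝ u z ≠ 0

/-- `f` vanishes to order at least `k` at `0`: all derivatives of order `< k` vanish at `0`. -/
def VanishesToOrder (f : E2 → ℝ) (k : ℕ) : Prop :=
  ∀ i < k, iteratedFDeriv ℝ i f 0 = 0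

/-- A real-analytic hypersurface `M = {ρ = 0}` in an open set `Ω ⊆ ℝ⁴`. -/
def IsHypersurface (ρ : E4 → ℝ) (Ω : Set E4) : Prop :=
  IsOpen Ω ∧ (∀ x ∈ Ω, AnalyticAt ℝ ρ x) ∧ ∀ ζ ∈ Ω, ρ ζ = 0 → fderiv ℝ ρ ζ ≠ 0

/-- The type `δ_M(p) ∈ ℕ ∪ {∞}` of `M = {ρ = 0}` at `p`: the smallest `k` such that no
regular `J`-holomorphic disk through `p` is such that `ρ ∘ γ` vanishes to order `≥ k+1`
at `0`, and `∞` if there is no such `k`. -/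
def hypType (J : E4 → E4 →L[ℝ] E4) (ρ : E4 → ℝ) (p : E4) : ℕ∞ :=
  sInf {n : ℕ∞ | ∃ k : ℕ, n = (k : ℕ∞) ∧
    ∀ V γ, IsJHolDisk J V γ → IsRegularOn γ V → γ 0 = p →
      ¬ VanishesToOrder (fun z => ρ (γ z)) (k + 1)}

section
open Set

abbrev I2 : Type := Fin 2 →₀ ℕ
abbrev PS : Type := MvPowerSeries (Fin 2) ℝ

def wt (n : I2) : ℝ := ((Nat.choose (n 0 + n 1) (n 0) : ℕ) : ℝ)⁻¹

lemma wt_pos (n : I2) : 0 < wt n := by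
  unfold wt
  have : 0 < Nat.choose (n 0 + n 1) (n 0) := Nat.choose_pos (by omega)
  positivity

lemma wt_zero : wt 0 = 1 := by simp [wt]

lemma wt_mul (a b : I2) : wt (a + b) ≤ wt a * wt b := by
  unfold wt
  rw [← mul_inv]
  have h1 : 0 < Nat.choose (a 0 + a 1) (a 0) := Nat.choose_pos (by omega)
  have h2 : 0 < Nat.choose (b 0 + b 1) (b 0) := Nat.choose_pos (by omega)
  apply inv_anti₀
  · positivity
  · norm_cast
    simp only [Finsupp.add_apply]
    have e : a 0 + b 0 + (a 1 + b 1) = (a 0 + a 1) + (b 0 + b 1) := by omega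
    rw [e, Nat.add_choose_eq (a 0 + a 1) (b 0 + b 1)]
    exact Finset.single_le_sum (f := fun ij : ℕ × ℕ => (a 0 + a 1).choose ij.1 * (b 0 + b 1).choose ij.2)
      (fun _ _ => Nat.zero_le _) (Finset.HasAntidiagonal.mem_antidiagonal.2 (rfl : (a 0, b 0).1 + (a 0, b 0).2 = a 0 + b 0))

lemma wt_ge (n : I2) : (1/2 : ℝ) ^ (n 0 + n 1) ≤ wt n := by
  unfold wt
  have h1 : 0 < Nat.choose (n 0 + n 1) (n 0) := Nat.choose_pos (by omega)
  rw [one_div, inv_pow]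
  apply inv_anti₀
  · positivity
  · exact_mod_cast Nat.choose_le_two_pow _ _

/-- key identity -/
lemma wt_shift (n : I2) : wt (n + Finsupp.single 1 1) / (n 1 + 1) =
    wt (n + Finsupp.single 0 1) / (n 0 + 1) := by
  unfold wt
  simp only [Finsupp.add_apply, Finsupp.single_apply]
  norm_num
  have h1 := Nat.add_choose_mul_factorial_mul_factorial (n 1 + 1) (n 0)
  have h2 := Nat.add_choose_mul_factorial_mul_factorial (n 1) (n 0 + 1)
  have e : n 0 + 1 + n 1 = n 0 + (n 1 + 1) := by omega
  have e' : n 1 + 1 + n 0 = n 0 + (n 1 + 1) := by omega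
  have e2 : n 1 + (n 0 + 1) = n 0 + (n 1 + 1) := by omega
  rw [e'] at h1
  rw [e2] at h2
  rw [e]
  have h3 : (n 0 + (n 1 + 1)).choose (n 0) * (n 1 + 1) = (n 0 + (n 1 + 1)).choose (n 0 + 1) * (n 0 + 1) := by
    have : (n 0 + (n 1 + 1)).choose (n 0) * (n 1 + 1) * (Nat.factorial (n 0) * Nat.factorial (n 1)) = (n 0 + (n 1 + 1)).choose (n 0 + 1) * (n 0 + 1) * (Nat.factorial (n 0) * Nat.factorial (n 1)) := by
      rw [Nat.factorial_succ] at h1 h2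
      rw [← h1] at h2
      linarith
    exact Nat.eq_of_mul_eq_mul_right (by positivity) this
  have h3' : ((n 0 + (n 1 + 1)).choose (n 0) : ℝ) * (n 1 + 1) = (n 0 + (n 1 + 1)).choose (n 0 + 1) * (n 0 + 1) := by exact_mod_cast h3
  rw [div_eq_mul_inv, div_eq_mul_inv, ← mul_inv, ← mul_inv]
  rw [h3']

open MvPowerSeries in
lemma conv_bound (f g : PS) (n : I2) : |coeff n (f * g)| * wt n ≤
    ∑ x ∈ Finset.HasAntidiagonal.antidiagonal n,
      (|coeff x.1 f| * wt x.1) * (|coeff x.2 g| * wt x.2) := by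
  rw [coeff_mul]
  refine (mul_le_mul_of_nonneg_right (Finset.abs_sum_le_sum_abs _ _) (wt_pos n).le).trans ?_
  rw [Finset.sum_mul]
  refine Finset.sum_le_sum fun x hx => ?_
  rw [← Finset.HasAntidiagonal.mem_antidiagonal.1 hx, abs_mul]
  calc _ ≤ |coeff x.1 f| * |coeff x.2 g| * (wt x.1 * wt x.2) :=
        mul_le_mul_of_nonneg_left (wt_mul _ _) (by positivity)
    _ = _ := by ring

def SumA (f : PS) : Prop := Summable fun n => |MvPowerSeries.coeff n f| * wt n

lemma sum_conv {c d : I2 → ℝ} (hc : Summable c) (hd : Summable d) (hc0 : ∀ n, 0 ≤ c n)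
    (hd0 : ∀ n, 0 ≤ d n) :
    Summable (fun n : I2 => ∑ x ∈ Finset.HasAntidiagonal.antidiagonal n, c x.1 * d x.2) ∧
    (∑' n, c n) * (∑' n, d n) = ∑' n : I2, ∑ x ∈ Finset.HasAntidiagonal.antidiagonal n, c x.1 * d x.2 := by
  have hp := Summable.mul_of_nonneg hc hd hc0 hd0
  exact ⟨summable_sum_mul_antidiagonal_of_summable_mul hp,
    hc.tsum_mul_tsum_eq_tsum_sum_antidiagonal hd hp⟩

lemma SumA.mul {f g : PS} (hf : SumA f) (hg : SumA g) : SumA (f * g) := by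
  unfold SumA at *
  have hs := (sum_conv hf hg (fun n => mul_nonneg (abs_nonneg _) (wt_pos n).le)
        (fun n => mul_nonneg (abs_nonneg _) (wt_pos n).le)).1
  exact Summable.of_nonneg_of_le (fun n => mul_nonneg (abs_nonneg _) (wt_pos n).le)
    (conv_bound f g) hs

open MvPowerSeries in
def SA : Subalgebra ℝ PS where
  carrier := {f | SumA f}
  mul_mem' := SumA.mul
  add_mem' := by
    intro f g hf hg
    refine Summable.of_nonneg_of_le (fun n => mul_nonneg (abs_nonneg _) (wt_pos n).le) ?_ (hf.add hg)
    intro n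
    rw [map_add, ← add_mul]
    exact mul_le_mul_of_nonneg_right (abs_add_le _ _) (wt_pos n).le
  algebraMap_mem' := by
    intro r
    refine summable_of_ne_finset_zero (s := {0}) ?_
    intro n hn
    simp only [Finset.mem_singleton] at hn
    simp [MvPowerSeries.algebraMap_apply, coeff_C, hn]

def AA : Type := SA

instance : CommRing AA := inferInstanceAs (CommRing SA)
instance : Algebra ℝ AA := inferInstanceAs (Algebra ℝ SA)

namespace AA

def cf (n : I2) (f : AA) : ℝ := MvPowerSeries.coeff n f.1

lemma summ (f : AA) : Summable fun n => |cf n f| * wt n := f.2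

lemma cf_add (n : I2) (f g : AA) : cf n (f + g) = cf n f + cf n g := by
  exact map_add (MvPowerSeries.coeff n) f.1 g.1
lemma cf_neg (n : I2) (f : AA) : cf n (-f) = -cf n f := by
  exact map_neg (MvPowerSeries.coeff n) f.1
lemma cf_smul (n : I2) (r : ℝ) (f : AA) : cf n (r • f) = r * cf n f := by
  exact map_smul (MvPowerSeries.coeff n) r f.1
lemma cf_zero (n : I2) : cf n 0 = 0 := map_zero (MvPowerSeries.coeff n)
lemma cf_one (n : I2) : cf n 1 = if n = 0 then 1 else 0 := MvPowerSeries.coeff_one n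
lemma cf_mul (n : I2) (f g : AA) : cf n (f * g) = ∑ x ∈ Finset.HasAntidiagonal.antidiagonal n, cf x.1 f * cf x.2 g :=
  MvPowerSeries.coeff_mul n f.1 g.1
lemma ext' {f g : AA} (h : ∀ n, cf n f = cf n g) : f = g := Subtype.ext (MvPowerSeries.ext h)

def mk (c : I2 → ℝ) (h : Summable fun n => |c n| * wt n) : AA := ⟨fun n => c n, h⟩
lemma cf_mk (c : I2 → ℝ) (h) (n : I2) : cf n (mk c h) = c n := rfl

def nrm (f : AA) : ℝ := ∑' n, |cf n f| * wt n

lemma nn (f : AA) (n : I2) : 0 ≤ |cf n f| * wt n := mul_nonneg (abs_nonneg _) (wt_pos n).le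

lemma nrm_le_of_le (f : AA) {u : I2 → ℝ} (hu : Summable u) (h : ∀ n, |cf n f| * wt n ≤ u n) :
    nrm f ≤ ∑' n, u n := Summable.tsum_le_tsum h f.summ hu

def rnorm : RingNorm AA where
  toFun := nrm
  map_zero' := by simp [nrm, cf_zero]
  add_le' f g := by
    rw [nrm, nrm, nrm, ← f.summ.tsum_add g.summ]
    refine Summable.tsum_le_tsum ?_ (f+g).summ (f.summ.add g.summ)
    intro n
    rw [cf_add, ← add_mul]
    exact mul_le_mul_of_nonneg_right (abs_add_le _ _) (wt_pos n).le
  neg' f := by simp [nrm, cf_neg]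
  mul_le' f g := by
    obtain ⟨hs, he⟩ := sum_conv f.summ g.summ (nn f) (nn g)
    rw [nrm, nrm, nrm, he]
    refine nrm_le_of_le _ hs ?_
    exact conv_bound f.1 g.1
  eq_zero_of_map_eq_zero' f h := by
    have h' := (hasSum_zero_iff_of_nonneg (nn f)).1 (by
      have := f.summ.hasSum
      have e : ∑' n, |cf n f| * wt n = 0 := h
      rwa [e] at this)
    refine ext' fun n => ?_
    have := congrFun h' n
    simp only [Pi.zero_apply, mul_eq_zero, abs_eq_zero, (wt_pos n).ne', or_false] at this
    rw [this, cf_zero]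

instance instNR : NormedRing AA := rnorm.toNormedRing
instance : NormedCommRing AA := { instNR with mul_comm := mul_comm }

lemma norm_def (f : AA) : ‖f‖ = ∑' n, |cf n f| * wt n := rfl

instance : NormedAlgebra ℝ AA where
  norm_smul_le r f := by
    rw [norm_def, norm_def, ← tsum_mul_left]
    apply le_of_eq
    congr 1; ext n
    rw [cf_smul, abs_mul, mul_assoc]; rfl

instance : NormOneClass AA where
  norm_one := by
    rw [norm_def, tsum_eq_single 0]
    · simp [cf_one, wt_zero]
    · intro n hn
      simp [cf_one, hn]

def toLp (f : AA) : lp (fun _ : I2 => ℝ) 1 := ⟨fun n => cf n f * wt n, by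
  refine memℓp_gen ?_
  simpa [abs_mul, abs_of_pos (wt_pos _)] using f.summ⟩

lemma toLp_iso : Isometry toLp := by
  refine Isometry.of_dist_eq fun f g => ?_
  rw [dist_eq_norm, dist_eq_norm, lp.norm_eq_tsum_rpow (by simp), norm_def]
  simp only [ENNReal.toReal_one, Real.rpow_one, ne_eq, one_ne_zero, not_false_eq_true, div_self]
  congr 1; ext n
  have : cf n (f - g) = cf n f - cf n g := by rw [sub_eq_add_neg, cf_add, cf_neg, sub_eq_add_neg]
  rw [this]
  show ‖cf n f * wt n - cf n g * wt n‖ = _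
  rw [← sub_mul, norm_mul, Real.norm_eq_abs, Real.norm_eq_abs, abs_of_pos (wt_pos n)]

lemma toLp_surj : Function.Surjective toLp := by
  intro v
  have hv := (lp.memℓp v)
  have hv' := hv.summable (by simp)
  refine ⟨mk (fun n => v n / wt n) ?_, ?_⟩
  · refine hv'.congr fun n => ?_
    simp [abs_div, abs_of_pos (wt_pos n), (wt_pos n).ne']
  · ext n
    show v n / wt n * wt n = v n
    field_simp [(wt_pos n).ne']

instance : CompleteSpace AA :=
  (toLp_iso.isUniformInducing.completeSpace_congr toLp_surj).2 inferInstance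

end AA

end

section
open Set

lemma addSingle_inj (i : Fin 2) : Function.Injective (fun n : I2 => n + Finsupp.single i 1) :=
  fun _ _ h => add_right_cancel h

lemma mem_range_addSingle {i : Fin 2} {n : I2} (h : n i ≠ 0) :
    n ∈ Set.range (fun n : I2 => n + Finsupp.single i 1) :=
  ⟨n - Finsupp.single i 1, by
    ext j
    simp only [Finsupp.add_apply, Finsupp.tsub_apply, Finsupp.single_apply]
    split_ifs with hj
    · subst hj; omega
    · omega⟩

lemma range_zero {i : Fin 2} {F : I2 → ℝ} (hF : ∀ n, n i = 0 → F n = 0) :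
    ∀ n, n ∉ Set.range (fun n : I2 => n + Finsupp.single i 1) → F n = 0 := by
  intro n hn
  by_contra h
  exact hn (mem_range_addSingle fun h0 => h (hF n h0))

open MvPowerSeries

def Tc (f g : PS) (n : I2) : ℝ :=
  if n 1 = 0 then 0 else coeff (n - Finsupp.single 1 1) (f * pderiv ℝ 0 g) / n 1

lemma Tc_zero (f g : PS) (n : I2) (h : n 1 = 0) : Tc f g n = 0 := by simp [Tc, h]

lemma Tc_shift (f g : PS) (n : I2) : Tc f g (n + Finsupp.single 1 1) =
    coeff n (f * pderiv ℝ 0 g) / (n 1 + 1) := by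
  simp [Tc]

lemma Tc_bound (f g : PS) (n : I2) :
    |Tc f g (n + Finsupp.single 1 1)| * wt (n + Finsupp.single 1 1) ≤
    ∑ x ∈ Finset.HasAntidiagonal.antidiagonal n,
      (|coeff x.1 f| * wt x.1) *
      (|coeff (x.2 + Finsupp.single 0 1) g| * wt (x.2 + Finsupp.single 0 1)) := by
  have h1 : (0:ℝ) < n 1 + 1 := by positivity
  have h0 : (0:ℝ) < n 0 + 1 := by positivity
  rw [Tc_shift, abs_div, abs_of_pos h1, div_mul_eq_mul_div, mul_div_assoc, wt_shift, coeff_mul]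
  have hw := wt_pos (n + Finsupp.single 0 1)
  refine (mul_le_mul_of_nonneg_right (Finset.abs_sum_le_sum_abs _ _) (by positivity)).trans ?_
  rw [Finset.sum_mul]
  refine Finset.sum_le_sum fun x hx => ?_
  have hn := Finset.HasAntidiagonal.mem_antidiagonal.1 hx
  rw [coeff_pderiv, abs_mul, abs_mul]
  have hx0 : (0:ℝ) ≤ (x.2 0 : ℝ) + 1 := by positivity
  have hle : (x.2 0 : ℝ) + 1 ≤ n 0 + 1 := by
    rw [← hn]; simp
  rw [abs_of_nonneg hx0]
  have hw2 : wt (n + Finsupp.single 0 1) ≤ wt x.1 * wt (x.2 + Finsupp.single 0 1) := by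
    rw [← hn, add_assoc]; exact wt_mul _ _
  have hq : ((x.2 0 : ℝ) + 1) * (wt (n + Finsupp.single 0 1) / (n 0 + 1)) ≤
      wt x.1 * wt (x.2 + Finsupp.single 0 1) := by
    refine le_trans ?_ hw2
    rw [mul_div_assoc', div_le_iff₀ h0, mul_comm]
    exact mul_le_mul_of_nonneg_left hle hw.le
  calc _ = |coeff x.1 f| * |coeff (x.2 + Finsupp.single 0 1) g| *
        (((x.2 0 : ℝ) + 1) * (wt (n + Finsupp.single 0 1) / (n 0 + 1))) := by ring
    _ ≤ |coeff x.1 f| * |coeff (x.2 + Finsupp.single 0 1) g| *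
        (wt x.1 * wt (x.2 + Finsupp.single 0 1)) := mul_le_mul_of_nonneg_left hq (by positivity)
    _ = _ := by ring

lemma Tc_summ (f g : AA) : (Summable fun n => |Tc f.1 g.1 n| * wt n) ∧
    ∑' n, |Tc f.1 g.1 n| * wt n ≤ ‖f‖ * ‖g‖ := by
  have hz : ∀ n : I2, n 1 = 0 → |Tc f.1 g.1 n| * wt n = 0 := fun n hn => by
    rw [Tc_zero _ _ _ hn]; simp
  have hg' : Summable fun n : I2 => |AA.cf (n + Finsupp.single 0 1) g| * wt (n + Finsupp.single 0 1) :=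
    g.summ.comp_injective (addSingle_inj 0)
  obtain ⟨hs, he⟩ := sum_conv f.summ hg' (AA.nn f) (fun n => AA.nn g _)
  have hS : Summable fun n => |Tc f.1 g.1 (n + Finsupp.single 1 1)| * wt (n + Finsupp.single 1 1) :=
    Summable.of_nonneg_of_le (fun n => mul_nonneg (abs_nonneg _) (wt_pos _).le) (Tc_bound f.1 g.1) hs
  refine ⟨((addSingle_inj 1).summable_iff (range_zero hz)).1 hS, ?_⟩
  have e : ∑' n, |Tc f.1 g.1 (n + Finsupp.single 1 1)| * wt (n + Finsupp.single 1 1) =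
      ∑' n, |Tc f.1 g.1 n| * wt n := by
    refine (addSingle_inj 1).tsum_eq (f := fun n => |Tc f.1 g.1 n| * wt n) ?_
    intro n hn
    by_contra h
    exact hn (range_zero hz n h)
  rw [← e]
  refine (Summable.tsum_le_tsum (Tc_bound f.1 g.1) hS hs).trans ?_
  refine he.symm.le.trans ?_
  rw [AA.norm_def, AA.norm_def]
  refine mul_le_mul_of_nonneg_left ?_ (tsum_nonneg (AA.nn f))
  exact tsum_comp_le_tsum_of_inj g.summ (AA.nn g) (addSingle_inj 0)

def TT (f g : AA) : AA := AA.mk (Tc f.1 g.1) (Tc_summ f g).1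

lemma Tc_add_left (f f' g : PS) (n) : Tc (f + f') g n = Tc f g n + Tc f' g n := by
  unfold Tc; split_ifs <;> simp [add_mul, add_div]
lemma Tc_add_right (f g g' : PS) (n) : Tc f (g + g') n = Tc f g n + Tc f g' n := by
  unfold Tc; split_ifs <;> simp [mul_add, add_div]
lemma Tc_smul_left (r : ℝ) (f g : PS) (n) : Tc (r • f) g n = r * Tc f g n := by
  unfold Tc; split_ifs <;> simp [mul_div_assoc]
lemma Tc_smul_right (r : ℝ) (f g : PS) (n) : Tc f (r • g) n = r * Tc f g n := by
  unfold Tc; split_ifs <;> simp [mul_div_assoc]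

def TL : AA →L[ℝ] AA →L[ℝ] AA :=
  LinearMap.mkContinuous₂ (LinearMap.mk₂ ℝ TT
    (fun f f' g => AA.ext' fun n => (Tc_add_left f.1 f'.1 g.1 n).trans (AA.cf_add n (TT f g) (TT f' g)).symm)
    (fun r f g => AA.ext' fun n => (Tc_smul_left r f.1 g.1 n).trans (AA.cf_smul n r (TT f g)).symm)
    (fun f g g' => AA.ext' fun n => (Tc_add_right f.1 g.1 g'.1 n).trans (AA.cf_add n (TT f g) (TT f g')).symm)
    (fun r f g => AA.ext' fun n => (Tc_smul_right r f.1 g.1 n).trans (AA.cf_smul n r (TT f g)).symm))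
    1 (fun f g => by rw [one_mul]; exact (Tc_summ f g).2)

lemma TL_val (f g : AA) : (TL f g : AA).1 = Tc f.1 g.1 := rfl

lemma pderiv_TL (f g : AA) : pderiv ℝ 1 (TL f g : AA).1 = f.1 * pderiv ℝ 0 g.1 := by
  ext n
  rw [coeff_pderiv]
  have : coeff (n + Finsupp.single 1 1) (TL f g : AA).1 = Tc f.1 g.1 (n + Finsupp.single 1 1) := rfl
  rw [this, Tc_shift]
  have h1 : (n 1 : ℝ) + 1 ≠ 0 := by positivity
  field_simp

/-! evaluation -/

def Sr (f : PS) (r : ℝ) : Prop := Summable fun n => |coeff n f| * r ^ (n 0 + n 1)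
def mon (z : E2) (n : I2) : ℝ := z.1 ^ (n 0) * z.2 ^ (n 1)
def EV (f : PS) (z : E2) : ℝ := ∑' n, coeff n f * mon z n

lemma mon_bound {z : E2} {r : ℝ} (hz : ‖z‖ ≤ r) (n : I2) : |mon z n| ≤ r ^ (n 0 + n 1) := by
  unfold mon
  rw [abs_mul, abs_pow, abs_pow, pow_add]
  have h1 : |z.1| ≤ r := (norm_fst_le z).trans hz
  have h2 : |z.2| ≤ r := (norm_snd_le z).trans hz
  have : 0 ≤ r := (abs_nonneg _).trans h1
  gcongr

lemma Sr.mono {f : PS} {r r' : ℝ} (h : Sr f r') (h0 : 0 ≤ r) (hr : r ≤ r') : Sr f r := by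
  refine Summable.of_nonneg_of_le (fun n => by positivity) (fun n => ?_) h
  gcongr

lemma Sr_AA (f : AA) : Sr f.1 (1/2) := by
  refine Summable.of_nonneg_of_le (fun n => by positivity) (fun n => ?_) f.summ
  exact mul_le_mul_of_nonneg_left (wt_ge n) (abs_nonneg _)

lemma Sr.summ {f : PS} {r : ℝ} (h : Sr f r) {z : E2} (hz : ‖z‖ ≤ r) :
    Summable fun n => |coeff n f * mon z n| := by
  refine Summable.of_nonneg_of_le (fun n => by positivity) (fun n => ?_) h
  rw [abs_mul]
  exact mul_le_mul_of_nonneg_left (mon_bound hz n) (abs_nonneg _)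

lemma mon_add (z : E2) (a b : I2) : mon z (a + b) = mon z a * mon z b := by
  simp only [mon, Finsupp.add_apply, pow_add]; ring

lemma sum_conv' {c d : I2 → ℝ} (hc : Summable fun n => |c n|) (hd : Summable fun n => |d n|) :
    (∑' n, c n) * (∑' n, d n) = ∑' n : I2, ∑ x ∈ Finset.HasAntidiagonal.antidiagonal n, c x.1 * d x.2 := by
  have hc' : Summable c := hc.of_abs
  have hd' : Summable d := hd.of_abs
  have hp : Summable fun x : I2 × I2 => c x.1 * d x.2 := summable_mul_of_summable_norm hc hd
  exact hc'.tsum_mul_tsum_eq_tsum_sum_antidiagonal hd' hp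

lemma EV_mul {f g : PS} {r : ℝ} (hf : Sr f r) (hg : Sr g r) {z : E2} (hz : ‖z‖ ≤ r) :
    EV (f * g) z = EV f z * EV g z := by
  unfold EV
  rw [sum_conv' (hf.summ hz) (hg.summ hz)]
  congr 1; ext n
  rw [coeff_mul, Finset.sum_mul]
  refine Finset.sum_congr rfl fun x hx => ?_
  rw [← Finset.HasAntidiagonal.mem_antidiagonal.1 hx, mon_add]; ring

lemma pow_aux {r r' : ℝ} (h0 : 0 ≤ r) (hr : r < r') (N : ℕ) :
    (N + 1) * r ^ N ≤ (r' - r)⁻¹ * r' ^ (N + 1) := by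
  have hd : 0 < r' - r := by linarith
  rw [inv_mul_eq_div, le_div_iff₀ hd]
  have key : ∀ N : ℕ, r ^ (N+1) + (N + 1) * r ^ N * (r' - r) ≤ r' ^ (N + 1) := by
    intro N
    induction N with
    | zero => simp
    | succ k ih =>
      have h2 : r' * (r ^ (k+1) + (k + 1) * r ^ k * (r' - r)) ≤ r' ^ (k + 2) := by
        rw [pow_succ' r' (k+1)]
        exact mul_le_mul_of_nonneg_left ih (by linarith)
      have h3 : 0 ≤ (k + 1) * r ^ k * (r' - r) ^ 2 := by positivity
      push_cast
      have : r' * (r ^ (k+1) + (k + 1) * r ^ k * (r' - r)) =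
        r ^ (k + 2) + ((k:ℝ) + 1 + 1) * r ^ (k+1) * (r' - r) + (k + 1) * r ^ k * (r' - r) ^ 2 := by
        ring
      have e : r ^ (k+1+1) = r ^ (k+2) := rfl
      have e' : r' ^ (k+1+1) = r' ^ (k+2) := rfl
      rw [e, e']
      linarith
  have := key N
  have h4 : 0 ≤ r ^ (N+1) := by positivity
  linarith

lemma deg_add_single (n : I2) (i : Fin 2) :
    (n + Finsupp.single i 1 : I2) 0 + (n + Finsupp.single i 1 : I2) 1 = n 0 + n 1 + 1 := by
  fin_cases i <;> simp [Finsupp.single_apply] <;> omega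

lemma le_deg (n : I2) (i : Fin 2) : n i ≤ n 0 + n 1 := by
  fin_cases i <;> simp

lemma Sr.pderiv {f : PS} {r r' : ℝ} (h : Sr f r') (h0 : 0 ≤ r) (hr : r < r') (i : Fin 2) :
    Sr (pderiv ℝ i f) r := by
  have h1 : Summable fun n : I2 => |coeff (n + Finsupp.single i 1) f| * r' ^ (n 0 + n 1 + 1) := by
    have := h.comp_injective (addSingle_inj i)
    refine this.congr fun n => ?_
    simp only [Function.comp, deg_add_single]
  refine Summable.of_nonneg_of_le (fun n => by positivity) (fun n => ?_) (h1.mul_left (r' - r)⁻¹)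
  rw [coeff_pderiv, abs_mul]
  have h2 := pow_aux h0 hr (n 0 + n 1)
  have h3 : |(n i : ℝ) + 1| ≤ ((n 0 + n 1 : ℕ) : ℝ) + 1 := by
    rw [abs_of_nonneg (by positivity)]
    gcongr
    exact le_deg n i
  calc _ = |coeff (n + Finsupp.single i 1) f| * (|(n i : ℝ) + 1| * r ^ (n 0 + n 1)) := by ring
    _ ≤ |coeff (n + Finsupp.single i 1) f| * ((r' - r)⁻¹ * r' ^ (n 0 + n 1 + 1)) := by
      refine mul_le_mul_of_nonneg_left (le_trans ?_ h2) (abs_nonneg _)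
      gcongr
    _ = _ := by ring

def dmon (i : Fin 2) (z : E2) (n : I2) : ℝ :=
  if n i = 0 then 0 else n i * mon z (n - Finsupp.single i 1)

lemma dmon_bound {z : E2} {r : ℝ} (hz : ‖z‖ ≤ r) (i : Fin 2) (n : I2) :
    |dmon i z n| ≤ (n 0 + n 1 : ℕ) * r ^ (n 0 + n 1 - 1) := by
  unfold dmon
  have hr : 0 ≤ r := (norm_nonneg _).trans hz
  split_ifs with h
  · simp; positivity
  · rw [abs_mul, Nat.abs_cast]
    obtain ⟨m, rfl⟩ := mem_range_addSingle h
    have := mon_bound hz m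
    simp only [add_tsub_cancel_right, deg_add_single]
    gcongr
    rw [← deg_add_single m i]; exact le_deg _ _

lemma hasSum_dmon {f : PS} {r r' : ℝ} (h : Sr f r') (h0 : 0 ≤ r) (hr : r < r') (i : Fin 2)
    {z : E2} (hz : ‖z‖ ≤ r) :
    HasSum (fun n => coeff n f * dmon i z n) (EV (pderiv ℝ i f) z) := by
  have h1 : HasSum (fun n => coeff n (pderiv ℝ i f) * mon z n) (EV (pderiv ℝ i f) z) :=
    ((h.pderiv h0 hr i).summ hz).of_abs.hasSum
  refine ((addSingle_inj i).hasSum_iff (range_zero (F := fun n => coeff n f * dmon i z n) ?_)).1 ?_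
  · intro n hn; simp [dmon, hn]
  · convert h1 using 1
    ext n
    simp only [Function.comp, coeff_pderiv, dmon]
    simp
    ring

lemma mon_hasFDerivAt (n : I2) (z : E2) : HasFDerivAt (fun z => mon z n)
    (dmon 0 z n • ContinuousLinearMap.fst ℝ ℝ ℝ + dmon 1 z n • ContinuousLinearMap.snd ℝ ℝ ℝ) z := by
  have h1 : HasFDerivAt (fun z : E2 => z.1 ^ (n 0)) _ z := (hasFDerivAt_fst (𝕜 := ℝ) (p := z)).pow (n 0)
  have h2 : HasFDerivAt (fun z : E2 => z.2 ^ (n 1)) _ z := (hasFDerivAt_snd (𝕜 := ℝ) (p := z)).pow (n 1)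
  have h3 := h1.mul h2
  refine h3.congr_fderiv ?_
  ext
  · have e : dmon 0 z n = z.2 ^ n 1 * (n 0 * z.1 ^ (n 0 - 1)) := by
      by_cases h : n 0 = 0 <;> simp [dmon, mon, h]; ring
    simp [e]
  · have e : dmon 1 z n = z.1 ^ n 0 * (n 1 * z.2 ^ (n 1 - 1)) := by
      by_cases h : n 1 = 0 <;> simp [dmon, mon, h]; ring
    simp [e]

lemma EV_hasFDerivAt {f : PS} {r' : ℝ} (h : Sr f r') {z : E2} (hz : ‖z‖ < r') :
    HasFDerivAt (EV f) (EV (pderiv ℝ 0 f) z • ContinuousLinearMap.fst ℝ ℝ ℝ +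
      EV (pderiv ℝ 1 f) z • ContinuousLinearMap.snd ℝ ℝ ℝ) z := by
  obtain ⟨r, hr1, hr2⟩ := exists_between hz
  have h0 : 0 ≤ r := (norm_nonneg _).trans hr1.le
  set u : I2 → ℝ := fun n => |coeff n f| * (2 * ((n 0 + n 1 : ℕ) * r ^ (n 0 + n 1 - 1)))
  have hu : Summable u := by
    refine Summable.of_nonneg_of_le (fun n => by positivity) (fun n => ?_) (h.mul_left (2 * (r' - r)⁻¹))
    have : ((n 0 + n 1 : ℕ) : ℝ) * r ^ (n 0 + n 1 - 1) ≤ (r' - r)⁻¹ * r' ^ (n 0 + n 1) := by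
      rcases Nat.eq_zero_or_pos (n 0 + n 1) with h' | h'
      · rw [h']; simp; linarith
      · obtain ⟨N, hN⟩ := Nat.exists_eq_add_of_lt h'
        have hN' : n 0 + n 1 = N + 1 := by omega
        rw [hN']
        have := pow_aux h0 hr2 N
        push_cast
        simpa using this
    calc u n ≤ |coeff n f| * (2 * ((r' - r)⁻¹ * r' ^ (n 0 + n 1))) := by
          simp only [u]; gcongr
      _ = _ := by ring
  have key := hasFDerivAt_tsum_of_isPreconnected (𝕜 := ℝ) (s := Metric.ball (0 : E2) r) (u := u)
    (f := fun n z => coeff n f * mon z n)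
    (f' := fun n z => coeff n f • (dmon 0 z n • ContinuousLinearMap.fst ℝ ℝ ℝ + dmon 1 z n • ContinuousLinearMap.snd ℝ ℝ ℝ))
    (x₀ := z) (x := z) hu Metric.isOpen_ball (convex_ball _ _).isPreconnected
    (fun n x _ => (mon_hasFDerivAt n x).const_mul (coeff n f))
    (fun n x hx => by
      rw [norm_smul]
      refine mul_le_mul_of_nonneg_left ?_ (abs_nonneg _)
      have hx' : ‖x‖ ≤ r := (mem_ball_zero_iff.1 hx).le
      refine (norm_add_le _ _).trans ?_
      rw [norm_smul, norm_smul, two_mul]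
      have b0 := dmon_bound hx' 0 n
      have b1 := dmon_bound hx' 1 n
      have n0 := ContinuousLinearMap.norm_fst_le ℝ ℝ ℝ
      have n1 := ContinuousLinearMap.norm_snd_le ℝ ℝ ℝ
      refine add_le_add ?_ ?_
      · exact (mul_le_of_le_one_right (norm_nonneg _) n0).trans b0
      · exact (mul_le_of_le_one_right (norm_nonneg _) n1).trans b1)
    (mem_ball_zero_iff.2 hr1) (Summable.of_norm (h.summ hz.le)) (mem_ball_zero_iff.2 hr1)
  have e : HasSum (fun n => coeff n f • (dmon 0 z n • ContinuousLinearMap.fst ℝ ℝ ℝ + dmon 1 z n • ContinuousLinearMap.snd ℝ ℝ ℝ))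
      (EV (pderiv ℝ 0 f) z • ContinuousLinearMap.fst ℝ ℝ ℝ +
      EV (pderiv ℝ 1 f) z • ContinuousLinearMap.snd ℝ ℝ ℝ) := by
    have s0 := (hasSum_dmon h h0 hr2 0 hr1.le).smul_const (ContinuousLinearMap.fst ℝ ℝ ℝ)
    have s1 := (hasSum_dmon h h0 hr2 1 hr1.le).smul_const (ContinuousLinearMap.snd ℝ ℝ ℝ)
    convert s0.add s1 using 1
    ext1 n
    rw [smul_add, smul_smul, smul_smul]
  rw [e.tsum_eq] at key
  exact key

lemma EV_contDiffOn {δ : ℝ} (k : ℕ) : ∀ {f : PS}, (∀ r, 0 ≤ r → r < δ → Sr f r) →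
    ContDiffOn ℝ k (EV f) (Metric.ball 0 δ) := by
  have hd : ∀ {f : PS}, (∀ r, 0 ≤ r → r < δ → Sr f r) → ∀ z ∈ Metric.ball (0:E2) δ,
      HasFDerivAt (EV f) (EV (pderiv ℝ 0 f) z • ContinuousLinearMap.fst ℝ ℝ ℝ +
      EV (pderiv ℝ 1 f) z • ContinuousLinearMap.snd ℝ ℝ ℝ) z := by
    intro f hf z hz
    obtain ⟨r, hr1, hr2⟩ := exists_between (mem_ball_zero_iff.1 hz)
    exact EV_hasFDerivAt (hf r ((norm_nonneg _).trans hr1.le) hr2) hr1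
  induction k with
  | zero =>
    intro f hf
    simp only [Nat.cast_zero, contDiffOn_zero]
    exact fun z hz => (hd hf z hz).continuousAt.continuousWithinAt
  | succ k ih =>
    intro f hf
    have hf' : ∀ i, ∀ r, 0 ≤ r → r < δ → Sr (pderiv ℝ i f) r := by
      intro i r h0 hr
      obtain ⟨r', hr1, hr2⟩ := exists_between hr
      exact (hf r' (h0.trans hr1.le) hr2).pderiv h0 hr1 i
    push_cast
    rw [contDiffOn_succ_iff_fderiv_of_isOpen Metric.isOpen_ball]
    refine ⟨fun z hz => (hd hf z hz).differentiableAt.differentiableWithinAt, by simp, ?_⟩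
    refine ContDiffOn.congr (f := fun z => EV (pderiv ℝ 0 f) z • ContinuousLinearMap.fst ℝ ℝ ℝ +
      EV (pderiv ℝ 1 f) z • ContinuousLinearMap.snd ℝ ℝ ℝ) ?_ (fun z hz => (hd hf z hz).fderiv)
    exact ((ih (hf' 0)).smul contDiffOn_const).add ((ih (hf' 1)).smul contDiffOn_const)

lemma EV_smooth (f : AA) : ContDiffOn ℝ (⊤ : ℕ∞) (EV f.1) (Metric.ball 0 (1/2)) :=
  contDiffOn_infty.2 fun k => EV_contDiffOn k fun _ h0 hr => (Sr_AA f).mono h0 hr.le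

end

section
open Set
open MvPowerSeries
open scoped Topology

lemma abs_tsum_le_of {c d : I2 → ℝ} (h : Summable fun n => |c n|) (hd : Summable d)
    (hcd : ∀ n, |c n| ≤ d n) : |∑' n, c n| ≤ ∑' n, d n := by
  have h1 : ‖∑' n, c n‖ ≤ ∑' n, ‖c n‖ := norm_tsum_le_tsum_norm h
  exact h1.trans (Summable.tsum_le_tsum hcd h hd)

lemma EV_bound (f : AA) {z : E2} (hz : ‖z‖ ≤ 1/2) : |EV f.1 z| ≤ ‖f‖ := by
  have h := (Sr_AA f).summ hz
  rw [AA.norm_def]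
  refine abs_tsum_le_of h f.summ fun n => ?_
  rw [abs_mul]
  exact mul_le_mul_of_nonneg_left ((mon_bound hz n).trans (wt_ge n)) (abs_nonneg _)

lemma EV_add {f g : PS} {r : ℝ} (hf : Sr f r) (hg : Sr g r) {z : E2} (hz : ‖z‖ ≤ r) :
    EV (f + g) z = EV f z + EV g z := by
  unfold EV
  rw [← (hf.summ hz).of_abs.tsum_add (hg.summ hz).of_abs]
  congr 1; ext n; rw [map_add, add_mul]

lemma EV_C (a : ℝ) (z : E2) : EV (algebraMap ℝ PS a) z = a := by
  unfold EV
  rw [tsum_eq_single 0]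
  · simp [MvPowerSeries.algebraMap_apply, coeff_C, mon]
  · intro n hn
    simp [MvPowerSeries.algebraMap_apply, coeff_C, hn]

def evA (z : E2) (hz : ‖z‖ ≤ 1/2) : AA →ₐ[ℝ] ℝ where
  toFun f := EV f.1 z
  map_one' := by
    have := EV_C 1 z
    rw [map_one] at this
    exact this
  map_mul' f g := EV_mul (Sr_AA f) (Sr_AA g) hz
  map_zero' := by
    have := EV_C 0 z
    rw [map_zero] at this
    exact this
  map_add' f g := EV_add (Sr_AA f) (Sr_AA g) hz
  commutes' a := EV_C a z

def evL (z : E2) (hz : ‖z‖ ≤ 1/2) : AA →L[ℝ] ℝ :=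
  LinearMap.mkContinuous (evA z hz).toLinearMap 1 (fun f => by rw [one_mul]; exact EV_bound f hz)

def ee (j : Fin 4) : E4 := EuclideanSpace.single j 1

lemma E4_sum (c : Fin 4 → ℝ) : WithLp.toLp 2 c = ∑ j, c j • ee j := by
  ext i
  simp [ee, Pi.single_apply]

def QQ (P : FormalMultilinearSeries ℝ E4 ℝ) : FormalMultilinearSeries ℝ (Fin 4 → AA) AA := fun n =>
  ∑ k : Fin n → Fin 4, (P n (fun i => ee (k i))) •
    (ContinuousMultilinearMap.mkPiAlgebra ℝ (Fin n) AA).compContinuousLinearMap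
      (fun i => ContinuousLinearMap.proj (R := ℝ) (φ := fun _ : Fin 4 => AA) (k i))

lemma QQ_norm (P : FormalMultilinearSeries ℝ E4 ℝ) (n : ℕ) : ‖QQ P n‖ ≤ 4 ^ n * ‖P n‖ := by
  unfold QQ
  refine (norm_sum_le _ _).trans ?_
  have : ∀ k ∈ (Finset.univ : Finset (Fin n → Fin 4)), ‖(P n (fun i => ee (k i))) •
    (ContinuousMultilinearMap.mkPiAlgebra ℝ (Fin n) AA).compContinuousLinearMap
      (fun i => ContinuousLinearMap.proj (R := ℝ) (φ := fun _ : Fin 4 => AA) (k i))‖ ≤ ‖P n‖ := by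
    intro k _
    rw [norm_smul]
    have h1 : ‖P n (fun i => ee (k i))‖ ≤ ‖P n‖ := by
      refine ((P n).le_opNorm _).trans ?_
      simp [ee]
    have h2 : ‖(ContinuousMultilinearMap.mkPiAlgebra ℝ (Fin n) AA).compContinuousLinearMap
      (fun i => ContinuousLinearMap.proj (R := ℝ) (φ := fun _ : Fin 4 => AA) (k i))‖ ≤ 1 := by
      refine (ContinuousMultilinearMap.norm_compContinuousLinearMap_le _ _).trans ?_
      rw [ContinuousMultilinearMap.norm_mkPiAlgebra, one_mul]
      refine Finset.prod_le_one (fun _ _ => norm_nonneg _) (fun i _ => ?_)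
      refine ContinuousLinearMap.opNorm_le_bound _ zero_le_one fun w => ?_
      rw [one_mul]
      exact norm_le_pi_norm w (k i)
    exact (mul_le_of_le_one_right (norm_nonneg _) h2).trans h1
  refine (Finset.sum_le_sum this).trans ?_
  simp

lemma QQ_ev (P : FormalMultilinearSeries ℝ E4 ℝ) (n : ℕ) (w : Fin 4 → AA) (z : E2) (hz : ‖z‖ ≤ 1/2) :
    evL z hz (QQ P n (fun _ => w)) = P n (fun _ => WithLp.toLp 2 (fun j => EV (w j).1 z)) := by
  rw [E4_sum]
  rw [ContinuousMultilinearMap.map_sum]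
  unfold QQ
  rw [ContinuousMultilinearMap.sum_apply, map_sum]
  refine Finset.sum_congr rfl fun k _ => ?_
  rw [ContinuousMultilinearMap.map_smul_univ, ContinuousMultilinearMap.smul_apply, map_smul,
    ContinuousMultilinearMap.compContinuousLinearMap_apply, ContinuousMultilinearMap.mkPiAlgebra_apply]
  have : evL z hz (∏ i : Fin n, w (k i)) = ∏ i : Fin n, EV (w (k i)).1 z :=
    map_prod (evA z hz) _ _
  simp only [ContinuousLinearMap.proj_apply]
  rw [this, smul_eq_mul, smul_eq_mul, mul_comm]

theorem comp_exists (φ : E4 → ℝ) (p : E4) (hφ : AnalyticAt ℝ φ p) :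
    ∃ Φ : (Fin 4 → AA) → AA, AnalyticAt ℝ Φ 0 ∧ ∀ᶠ w in 𝓝 (0 : Fin 4 → AA), ∀ z : E2, ‖z‖ ≤ 1/2 →
      EV (Φ w).1 z = φ (p + WithLp.toLp 2 (fun j => EV (w j).1 z)) := by
  obtain ⟨P, r, hP⟩ := hφ
  obtain ⟨R, hR0, hRr⟩ := ENNReal.lt_iff_exists_nnreal_btwn.1 hP.r_pos
  have hR0' : 0 < R := by exact_mod_cast hR0
  obtain ⟨C, hC0, hC⟩ := P.norm_mul_pow_le_of_lt_radius (hRr.trans_le hP.r_le)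
  have hrad : ((R / 4 : NNReal) : ENNReal) ≤ (QQ P).radius := by
    refine (QQ P).le_radius_of_bound C fun n => ?_
    have := QQ_norm P n
    calc ‖QQ P n‖ * ((R / 4 : NNReal) : ℝ) ^ n ≤ (4 ^ n * ‖P n‖) * ((R / 4 : NNReal) : ℝ) ^ n := by gcongr
      _ = ‖P n‖ * R ^ n := by
        push_cast
        rw [div_pow]; field_simp
      _ ≤ C := hC n
  have hpos : 0 < (QQ P).radius := lt_of_lt_of_le (by
    rw [ENNReal.coe_pos]; positivity) hrad
  have hQ := (QQ P).hasFPowerSeriesOnBall hpos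
  refine ⟨(QQ P).sum, hQ.analyticAt, ?_⟩
  have hR4 : (0:ℝ) < (R:ℝ) / 4 := by positivity
  filter_upwards [Metric.ball_mem_nhds (0 : Fin 4 → AA) hR4] with w hw z hz
  rw [mem_ball_zero_iff] at hw
  have hw' : w ∈ Metric.eball (0 : Fin 4 → AA) (QQ P).radius := by
    refine Metric.eball_subset_eball hrad ?_
    rw [Metric.emetric_ball_nnreal, mem_ball_zero_iff]
    simpa using hw
  have s1 := (hQ.hasSum hw').mapL (evL z hz)
  simp only [QQ_ev, zero_add] at s1
  have hy : WithLp.toLp 2 (fun j => EV (w j).1 z) ∈ Metric.eball (0 : E4) r := by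
    refine Metric.eball_subset_eball hRr.le ?_
    rw [Metric.emetric_ball_nnreal, mem_ball_zero_iff, E4_sum]
    refine (norm_sum_le _ _).trans_lt ?_
    have : ∀ j ∈ (Finset.univ : Finset (Fin 4)), ‖EV (w j).1 z • ee j‖ ≤ ‖w‖ := by
      intro j _
      rw [norm_smul]
      have : ‖ee j‖ = 1 := by simp [ee]
      rw [this, mul_one]
      exact (EV_bound (w j) hz).trans (norm_le_pi_norm w j)
    refine (Finset.sum_le_sum this).trans_lt ?_
    simp
    linarith
  exact s1.unique (hP.hasSum hy)

end

section
open Set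
open MvPowerSeries
open scoped Topology

lemma EV_diff (f : AA) {z : E2} (hz : ‖z‖ < 1/2) : DifferentiableAt ℝ (EV f.1) z :=
  (EV_hasFDerivAt (Sr_AA f) hz).differentiableAt

lemma TL_dy (f g : AA) {z : E2} (hz : ‖z‖ < 1/2) :
    fderiv ℝ (EV (TL f g : AA).1) z (0, 1) = EV f.1 z * fderiv ℝ (EV g.1) z (1, 0) := by
  rw [(EV_hasFDerivAt (Sr_AA (TL f g)) hz).fderiv, (EV_hasFDerivAt (Sr_AA g) hz).fderiv, pderiv_TL]
  obtain ⟨r, hr1, hr2⟩ := exists_between hz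
  have h0 : 0 ≤ r := (norm_nonneg _).trans hr1.le
  rw [EV_mul ((Sr_AA f).mono h0 hr2.le) ((Sr_AA g).pderiv h0 hr2 0) hr1.le]
  simp

lemma TL_y0 (f g : AA) (x : ℝ) : EV (TL f g : AA).1 (x, 0) = 0 := by
  have h : ∀ n : I2, coeff n (TL f g : AA).1 * mon (x, 0) n = 0 := by
    intro n
    by_cases hn : n 1 = 0
    · have : coeff n (TL f g : AA).1 = 0 := Tc_zero _ _ n hn
      rw [this, zero_mul]
    · simp [mon, hn]
  unfold EV
  rw [tsum_congr h, tsum_zero]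

def XA : AA := ⟨X 0, by
  refine summable_of_ne_finset_zero (s := {Finsupp.single 0 1}) fun n hn => ?_
  rw [Finset.mem_singleton] at hn
  rw [coeff_X, if_neg hn]; simp⟩

lemma EV_XA (z : E2) : EV XA.1 z = z.1 := by
  unfold EV
  rw [tsum_eq_single (Finsupp.single 0 1)]
  · have : coeff (Finsupp.single 0 1) XA.1 = 1 := coeff_index_single_self_X _
    rw [this]; simp [mon]
  · intro n hn
    have : coeff n XA.1 = 0 := by
      show coeff n (X 0 : PS) = 0
      rw [coeff_X, if_neg hn]
    rw [this, zero_mul]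

lemma exists_w {B : Type} [NormedAddCommGroup B] [NormedSpace ℝ B] [CompleteSpace B]
    (T : B →L[ℝ] B →L[ℝ] B) (Φ : Fin 4 → Fin 4 → (Fin 4 → B) → B) (hΦ : ∀ j l, AnalyticAt ℝ (Φ j l) 0)
    (Q : (Fin 4 → B) → Prop) (hQ : ∀ᶠ w in 𝓝 0, Q w)
    (γ : ℝ → (Fin 4 → B)) (hγ : Continuous γ) (hγ0 : γ 0 = 0) :
    ∃ t : ℝ, 0 < t ∧ ∃ w, Q w ∧ ∀ j, w j = γ t j + t • ∑ l, T (Φ j l w) (w l) := by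
  let R : (Fin 4 → B) → (Fin 4 → B) := fun w j => ∑ l, T (Φ j l w) (w l)
  have hR0 : R 0 = 0 := by
    funext j; simp [R]
  have hRd : ∃ R' : (Fin 4 → B) →L[ℝ] (Fin 4 → B), HasStrictFDerivAt R R' 0 := by
    have : AnalyticAt ℝ R 0 := by
      refine AnalyticAt.pi fun j => ?_
      refine Finset.analyticAt_fun_sum _ fun l _ => ?_
      have h2 : AnalyticAt ℝ (fun w : Fin 4 → B => w l) 0 :=
        (ContinuousLinearMap.proj (R := ℝ) (φ := fun _ : Fin 4 => B) l).analyticAt 0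
      exact AnalyticAt.comp (g := fun q : B × B => T q.1 q.2) (T.analyticAt_bilinear _) ((hΦ j l).prod h2)
    exact ⟨_, this.hasStrictFDerivAt⟩
  obtain ⟨R', hR'⟩ := hRd
  let Ψ : ℝ × (Fin 4 → B) → ℝ × (Fin 4 → B) := fun q => (q.1, q.2 - q.1 • R q.2)
  have hΨ : HasStrictFDerivAt Ψ (ContinuousLinearEquiv.refl ℝ (ℝ × (Fin 4 → B)) : _ →L[ℝ] _) 0 := by
    have hf : HasStrictFDerivAt (fun q : ℝ × (Fin 4 → B) => q.1) (ContinuousLinearMap.fst ℝ _ _) 0 :=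
      hasStrictFDerivAt_fst
    have hs : HasStrictFDerivAt (fun q : ℝ × (Fin 4 → B) => q.2) (ContinuousLinearMap.snd ℝ _ _) 0 :=
      hasStrictFDerivAt_snd
    have hRs : HasStrictFDerivAt (fun q : ℝ × (Fin 4 → B) => R q.2)
      (R'.comp (ContinuousLinearMap.snd ℝ _ _)) 0 := HasStrictFDerivAt.comp (g := R) 0 hR' hs
    have := hf.prodMk (hs.sub (hf.smul hRs))
    refine this.congr_fderiv ?_
    ext q <;> simp [hR0]
  have hmap := hΨ.map_nhds_eq_of_equiv
  have hΨ0 : Ψ 0 = 0 := by simp [Ψ]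
  rw [hΨ0] at hmap
  have hQ' : ∀ᶠ q : ℝ × (Fin 4 → B) in 𝓝 0, Q q.2 :=
    (continuous_snd.tendsto (0 : ℝ × (Fin 4 → B))).eventually hQ
  have him : Ψ '' {q | Q q.2} ∈ 𝓝 (0 : ℝ × (Fin 4 → B)) := by
    rw [← hmap]; exact Filter.image_mem_map hQ'
  have hc : Filter.Tendsto (fun t : ℝ => (t, γ t)) (𝓝[>] 0) (𝓝 (0 : ℝ × (Fin 4 → B))) := by
    have : Continuous fun t : ℝ => (t, γ t) := by fun_prop
    have h2 := this.tendsto 0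
    rw [hγ0] at h2
    exact h2.mono_left nhdsWithin_le_nhds
  obtain ⟨t, ⟨⟨ε, w⟩, hw, he⟩, ht⟩ := ((hc.eventually him).and self_mem_nhdsWithin).exists
  refine ⟨t, ht, w, hw, fun j => ?_⟩
  have e1 : ε = t := congrArg Prod.fst he
  have e2 : w - ε • R w = γ t := congrArg Prod.snd he
  rw [← e2, e1]
  simp [R]

theorem CK {J : E4 → E4 →L[ℝ] E4} (hJ : IsAlmostComplex J) (p : E4) (a : ℕ → E4) (K : ℕ) :
    ∃ V u, IsJHolDisk J V u ∧
      ∀ x : ℝ, ((x, 0) : E2) ∈ V → u (x, 0) = p + ∑ i ∈ Finset.range K, x ^ (i + 1) • a i := by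
  have hφ : ∀ j l, AnalyticAt ℝ (fun q => (J q (ee l)) j) p := by
    intro j l
    have h1 : AnalyticAt ℝ (fun q => J q (ee l)) p := 
      ((ContinuousLinearMap.apply ℝ E4 (ee l)).analyticAt _).comp (hJ.1 p)
    exact ((EuclideanSpace.proj (𝕜 := ℝ) j : E4 →L[ℝ] ℝ).analyticAt _).comp h1
  choose Φ hΦ hΦe using fun j l => comp_exists _ p (hφ j l)
  have hQ : ∀ᶠ w in 𝓝 (0 : Fin 4 → AA), ∀ j l, ∀ z : E2, ‖z‖ ≤ 1/2 →
      EV (Φ j l w).1 z = (J (p + WithLp.toLp 2 (fun j => EV (w j).1 z)) (ee l)) j :=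
    Filter.eventually_all.2 fun j => Filter.eventually_all.2 fun l => hΦe j l
  let γ : ℝ → Fin 4 → AA := fun t j => ∑ i ∈ Finset.range K, (t ^ (i + 1) * a i j) • XA ^ (i + 1)
  obtain ⟨t, ht, w, hw, hweq⟩ := exists_w TL Φ hΦ _ hQ γ (by fun_prop) (by
    funext j; simp [γ])
  -- evaluation
  have hev : ∀ j, ∀ z : E2, ‖z‖ ≤ 1/2 → EV (w j).1 z =
      ∑ i ∈ Finset.range K, (t ^ (i + 1) * a i j) * z.1 ^ (i + 1) +
        t * ∑ l, EV (TL (Φ j l w) (w l) : AA).1 z := by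
    intro j z hz
    have h := congrArg (evA z hz) (hweq j)
    simp only [γ, map_add, map_sum, map_smul, map_pow, smul_eq_mul] at h
    have hx : evA z hz XA = z.1 := EV_XA z
    rw [hx] at h
    exact h
  have hdy : ∀ j, ∀ z : E2, ‖z‖ < 1/2 → fderiv ℝ (EV (w j).1) z (0, 1) =
      t * (J (p + WithLp.toLp 2 (fun j => EV (w j).1 z))
        (WithLp.toLp 2 fun l => fderiv ℝ (EV (w l).1) z (1, 0))) j := by
    intro j z hz
    have he : EV (w j).1 =ᶠ[𝓝 z] fun z : E2 => 
      ∑ i ∈ Finset.range K, (t ^ (i + 1) * a i j) * z.1 ^ (i + 1) +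
        t * ∑ l, EV (TL (Φ j l w) (w l) : AA).1 z := by
      have : ∀ᶠ z' : E2 in 𝓝 z, ‖z'‖ < 1/2 := continuous_norm.continuousAt.eventually_lt continuousAt_const hz
      filter_upwards [this] with z' hz' using hev j z' hz'.le
    have hd1 : HasFDerivAt (fun z : E2 => ∑ i ∈ Finset.range K, (t ^ (i + 1) * a i j) * z.1 ^ (i + 1))
        (∑ i ∈ Finset.range K, (t ^ (i + 1) * a i j) • (((i + 1 : ℕ) * z.1 ^ i : ℝ) • ContinuousLinearMap.fst ℝ ℝ ℝ)) z := by
      refine HasFDerivAt.fun_sum fun i _ => ?_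
      refine HasFDerivAt.const_mul ?_ _
      have := (hasFDerivAt_fst (𝕜 := ℝ) (p := z)).pow (i + 1)
      simpa using this
    have hd2 : HasFDerivAt (fun z : E2 => ∑ l, EV (TL (Φ j l w) (w l) : AA).1 z)
        (∑ l, fderiv ℝ (EV (TL (Φ j l w) (w l) : AA).1) z) z :=
      HasFDerivAt.fun_sum fun l _ => (EV_diff _ hz).hasFDerivAt
    have hd3 := (hd1.fun_add (hd2.const_mul t)).fderiv
    rw [he.fderiv_eq, hd3, E4_sum (fun l => fderiv ℝ (EV (w l).1) z (1, 0)), map_sum]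
    simp only [ContinuousLinearMap.add_apply, ContinuousLinearMap.sum_apply,
      ContinuousLinearMap.smul_apply, TL_dy _ _ hz, hw j _ z hz.le, map_smul]
    simp [mul_comm]
  let A : E2 →L[ℝ] E2 := (t⁻¹ • ContinuousLinearMap.fst ℝ ℝ ℝ).prod ((t ^ 2)⁻¹ • ContinuousLinearMap.snd ℝ ℝ ℝ)
  let V : Set E2 := A ⁻¹' (Metric.ball 0 (1/2))
  have hVo : IsOpen V := Metric.isOpen_ball.preimage A.continuous
  let v : E2 → (Fin 4 → ℝ) := fun z j => EV (w j).1 (A z)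
  let iso : (Fin 4 → ℝ) ≃L[ℝ] E4 := (EuclideanSpace.equiv (Fin 4) ℝ).symm
  let u : E2 → E4 := fun z => p + iso (v z)
  have hud : ∀ z ∈ V, HasFDerivAt u ((iso : (Fin 4 → ℝ) →L[ℝ] E4).comp
      (ContinuousLinearMap.pi fun j => (fderiv ℝ (EV (w j).1) (A z)).comp A)) z := by
    intro z hz
    have hz' : ‖A z‖ < 1/2 := by simpa [V] using hz
    have h1 : HasFDerivAt v (ContinuousLinearMap.pi fun j => (fderiv ℝ (EV (w j).1) (A z)).comp A) z := by
      refine hasFDerivAt_pi.2 fun j => ?_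
      exact HasFDerivAt.comp (g := EV (w j).1) z (EV_diff (w j) hz').hasFDerivAt A.hasFDerivAt
    exact ((iso : (Fin 4 → ℝ) →L[ℝ] E4).hasFDerivAt.comp z h1).const_add p
  refine ⟨V, u, ⟨hVo, by simp [V], ?_, ?_⟩, ?_⟩
  · refine contDiffOn_const.add (iso.contDiff.comp_contDiffOn ?_)
    refine contDiffOn_pi.2 fun j => ?_
    exact (EV_smooth (w j)).comp A.contDiff.contDiffOn (fun z hz => hz)
  · intro z hz
    have hz' : ‖A z‖ < 1/2 := by simpa [V] using hz
    have hy : fderiv ℝ u z (0, 1) = J (u z) (fderiv ℝ u z (1, 0)) := by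
      rw [(hud z hz).fderiv]
      have hA1 : A (0, 1) = (t ^ 2)⁻¹ • ((0, 1) : E2) := by simp [A]
      have hA2 : A (1, 0) = t⁻¹ • ((1, 0) : E2) := by simp [A]
      have hx : (iso : (Fin 4 → ℝ) →L[ℝ] E4).comp
        (ContinuousLinearMap.pi fun j => (fderiv ℝ (EV (w j).1) (A z)).comp A) (1, 0) =
        t⁻¹ • WithLp.toLp 2 fun l => fderiv ℝ (EV (w l).1) (A z) (1, 0) := by
        ext j
        show fderiv ℝ (EV (w j).1) (A z) (A (1, 0)) = _
        rw [hA2, map_smul]; rfl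
      rw [hx, map_smul]
      ext j
      show fderiv ℝ (EV (w j).1) (A z) (A (0, 1)) = t⁻¹ • _
      rw [hA1, map_smul, hdy j _ hz']
      have : (t ^ 2)⁻¹ * t = t⁻¹ := by field_simp
      rw [smul_eq_mul, ← mul_assoc, this]; rfl
    have hJJ : ∀ q v, J q (J q v) = -v := fun q v => by
      have := congrArg (fun L => L v) (hJ.2 q)
      simpa using this
    ext1
    · ext1
      show fderiv ℝ u z (J0 (1, 0)) = J (u z) (fderiv ℝ u z (1, 0))
      have : J0 (1, 0) = (0, 1) := by simp [J0]
      rw [this, hy]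
    · ext1
      show fderiv ℝ u z (J0 (0, 1)) = J (u z) (fderiv ℝ u z (0, 1))
      have : J0 (0, 1) = -(1, 0) := by simp [J0]
      rw [this, hy, hJJ, map_neg]
  · intro x hx
    have hz' : ‖A (x, 0)‖ < 1/2 := by simpa [V] using hx
    show p + iso (v (x, 0)) = _
    congr 1
    have hA : A (x, 0) = (t⁻¹ * x, 0) := by simp [A]
    ext j
    show EV (w j).1 (A (x, 0)) = _
    rw [hev j _ hz'.le, hA]
    simp only [TL_y0]
    simp [mul_pow]
    refine Finset.sum_congr rfl fun i _ => ?_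
    field_simp

end

section
open Set
open scoped Topology

section jets
variable {E F : Type} [NormedAddCommGroup E] [NormedSpace ℝ E] [NormedAddCommGroup F] [NormedSpace ℝ F]

def Dx (h : E2 → F) : E2 → F := fun z => fderiv ℝ h z (1, 0)
def Dy (h : E2 → F) : E2 → F := fun z => fderiv ℝ h z (0, 1)
def jet (m : ℕ) (u : E2 → F) (z : E2) : Fin (m + 1) → F := fun i => Dx^[(i : ℕ)] u z

lemma Dx_congr {V : Set E2} (hV : IsOpen V) {f g : E2 → F} (h : EqOn f g V) : EqOn (Dx f) (Dx g) V := by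
  intro z hz
  have : f =ᶠ[𝓝 z] g := Filter.eventuallyEq_of_mem (hV.mem_nhds hz) h
  simp only [Dx, this.fderiv_eq]

lemma Dy_congr {V : Set E2} (hV : IsOpen V) {f g : E2 → F} (h : EqOn f g V) : EqOn (Dy f) (Dy g) V := by
  intro z hz
  have : f =ᶠ[𝓝 z] g := Filter.eventuallyEq_of_mem (hV.mem_nhds hz) h
  simp only [Dy, this.fderiv_eq]

lemma Dxi_congr {V : Set E2} (hV : IsOpen V) {f g : E2 → F} (h : EqOn f g V) (i : ℕ) :
    EqOn (Dx^[i] f) (Dx^[i] g) V := by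
  induction i with
  | zero => exact h
  | succ i ih =>
    rw [Function.iterate_succ_apply', Function.iterate_succ_apply']
    exact Dx_congr hV ih

lemma fd_smooth {V : Set E} (hV : IsOpen V) {f : E → F} (h : ContDiffOn ℝ (⊤ : ℕ∞) f V) :
    ContDiffOn ℝ (⊤ : ℕ∞) (fderiv ℝ f) V := h.fderiv_of_isOpen hV (by simp)

lemma Dx_smooth {V : Set E2} (hV : IsOpen V) {f : E2 → F} (h : ContDiffOn ℝ (⊤ : ℕ∞) f V) :
    ContDiffOn ℝ (⊤ : ℕ∞) (Dx f) V := (fd_smooth hV h).clm_apply contDiffOn_const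

lemma Dy_smooth {V : Set E2} (hV : IsOpen V) {f : E2 → F} (h : ContDiffOn ℝ (⊤ : ℕ∞) f V) :
    ContDiffOn ℝ (⊤ : ℕ∞) (Dy f) V := (fd_smooth hV h).clm_apply contDiffOn_const

lemma Dxi_smooth {V : Set E2} (hV : IsOpen V) {f : E2 → F} (h : ContDiffOn ℝ (⊤ : ℕ∞) f V) (i : ℕ) :
    ContDiffOn ℝ (⊤ : ℕ∞) (Dx^[i] f) V := by
  induction i with
  | zero => exact h
  | succ i ih =>
    rw [Function.iterate_succ_apply']
    exact Dx_smooth hV ih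

lemma smooth_diff {V : Set E} (hV : IsOpen V) {f : E → F} (h : ContDiffOn ℝ (⊤ : ℕ∞) f V) {z : E}
    (hz : z ∈ V) : DifferentiableAt ℝ f z :=
  (h.contDiffAt (hV.mem_nhds hz)).differentiableAt (by simp)

lemma DxDy {V : Set E2} (hV : IsOpen V) {f : E2 → F} (h : ContDiffOn ℝ (⊤ : ℕ∞) f V) :
    EqOn (Dy (Dx f)) (Dx (Dy f)) V := by
  intro z hz
  have h1 : ContDiffAt ℝ (⊤ : ℕ∞) f z := h.contDiffAt (hV.mem_nhds hz)
  have hs : IsSymmSndFDerivAt ℝ f z := h1.isSymmSndFDerivAt (by simp; exact WithTop.coe_le_coe.2 (le_top : (2:ℕ∞) ≤ ⊤))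
  have hd : DifferentiableAt ℝ (fderiv ℝ f) z := smooth_diff hV (fd_smooth hV h) hz
  have e : ∀ v w : E2, fderiv ℝ (fun z => fderiv ℝ f z v) z w = fderiv ℝ (fderiv ℝ f) z w v := by
    intro v w
    rw [fderiv_clm_apply hd (differentiableAt_const v)]
    simp
  show fderiv ℝ (fun z => fderiv ℝ f z (1, 0)) z (0, 1) = fderiv ℝ (fun z => fderiv ℝ f z (0, 1)) z (1, 0)
  rw [e, e]
  exact hs _ _

lemma DxiDy {V : Set E2} (hV : IsOpen V) {f : E2 → F} (h : ContDiffOn ℝ (⊤ : ℕ∞) f V) (i : ℕ) :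
    EqOn (Dy (Dx^[i] f)) (Dx^[i] (Dy f)) V := by
  induction i with
  | zero => exact fun _ _ => rfl
  | succ i ih =>
    rw [Function.iterate_succ_apply', Function.iterate_succ_apply']
    exact (DxDy hV (Dxi_smooth hV h i)).trans (Dx_congr hV ih)

def OO (m : ℕ) (O : Set E) : Set (Fin (m + 1) → E) := {w | w 0 ∈ O}

lemma OO_open (m : ℕ) {O : Set E} (hO : IsOpen O) : IsOpen (OO m O) :=
  hO.preimage (continuous_apply 0)

lemma jet_diff {V : Set E2} (hV : IsOpen V) {u : E2 → E} (h : ContDiffOn ℝ (⊤ : ℕ∞) u V) (m : ℕ)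
    {z : E2} (hz : z ∈ V) : HasFDerivAt (jet m u) (ContinuousLinearMap.pi fun i : Fin (m + 1) =>
      fderiv ℝ (Dx^[(i : ℕ)] u) z) z :=
  hasFDerivAt_pi.2 fun i => (smooth_diff hV (Dxi_smooth hV h i) hz).hasFDerivAt

lemma jet_Dx {V : Set E2} (hV : IsOpen V) {u : E2 → E} (h : ContDiffOn ℝ (⊤ : ℕ∞) u V) (m : ℕ)
    {z : E2} (hz : z ∈ V) : fderiv ℝ (jet m u) z (1, 0) = Fin.tail (jet (m + 1) u z) := by
  rw [(jet_diff hV h m hz).fderiv]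
  funext i
  simp only [ContinuousLinearMap.pi_apply, Fin.tail, jet, Fin.val_succ, Function.iterate_succ_apply']
  rfl

lemma jet_init (m : ℕ) (u : E2 → E) (z : E2) : Fin.init (jet (m + 1) u z) = jet m u z := rfl

def initL (m : ℕ) : (Fin (m + 2) → E) →L[ℝ] (Fin (m + 1) → E) :=
  ContinuousLinearMap.pi fun i => ContinuousLinearMap.proj (R := ℝ) (φ := fun _ : Fin (m + 2) => E) i.castSucc
def tailL (m : ℕ) : (Fin (m + 2) → E) →L[ℝ] (Fin (m + 1) → E) :=
  ContinuousLinearMap.pi fun i => ContinuousLinearMap.proj (R := ℝ) (φ := fun _ : Fin (m + 2) => E) i.succ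

lemma initL_maps (m : ℕ) (O : Set E) : MapsTo (initL m) (OO (m + 1) O) (OO m O) := fun w hw => hw

lemma DxGood {O : Set E} (hO : IsOpen O) {m : ℕ} {Φ : (Fin (m + 1) → E) → F}
    (hΦ : ContDiffOn ℝ (⊤ : ℕ∞) Φ (OO m O)) :
    ∃ Φ' : (Fin (m + 2) → E) → F, ContDiffOn ℝ (⊤ : ℕ∞) Φ' (OO (m + 1) O) ∧
      ∀ (V : Set E2) (u : E2 → E), IsOpen V → ContDiffOn ℝ (⊤ : ℕ∞) u V → MapsTo u V O →
        ∀ T : E2 → F, EqOn T (fun z => Φ (jet m u z)) V →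
          EqOn (Dx T) (fun z => Φ' (jet (m + 1) u z)) V := by
  refine ⟨fun w => fderiv ℝ Φ (initL m w) (tailL m w), ?_, ?_⟩
  · exact ((fd_smooth (OO_open m hO) hΦ).comp (initL m).contDiff.contDiffOn (initL_maps m O)).clm_apply
      (tailL m).contDiff.contDiffOn
  · intro V u hV hu hm T hT z hz
    rw [Dx_congr hV hT hz]
    have hd : DifferentiableAt ℝ Φ (jet m u z) := smooth_diff (OO_open m hO) hΦ (hm hz)
    show fderiv ℝ (Φ ∘ jet m u) z (1, 0) = fderiv ℝ Φ (jet m u z) (Fin.tail (jet (m + 1) u z))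
    rw [fderiv_comp z hd (jet_diff hV hu m hz).differentiableAt, ContinuousLinearMap.comp_apply,
      jet_Dx hV hu m hz]

/-- leading term lemma -/
lemma leading {O : Set E} (hO : IsOpen O) {Λ : E → E →L[ℝ] F} (hΛ : ContDiffOn ℝ (⊤ : ℕ∞) Λ O) (m : ℕ) :
    ∃ S : (Fin (m + 1) → E) → F, ContDiffOn ℝ (⊤ : ℕ∞) S (OO m O) ∧
      ∀ (V : Set E2) (u : E2 → E), IsOpen V → ContDiffOn ℝ (⊤ : ℕ∞) u V → MapsTo u V O →
        ∀ T : E2 → F, EqOn T (fun z => Λ (u z) (Dx u z)) V →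
          EqOn (Dx^[m] T) (fun z => Λ (u z) (Dx^[m + 1] u z) + S (jet m u z)) V := by
  induction m with
  | zero => 
    refine ⟨fun _ => 0, contDiffOn_const, fun V u hV hu hm T hT z hz => ?_⟩
    simpa using hT hz
  | succ m ih =>
    obtain ⟨S, hS, h⟩ := ih
    obtain ⟨S', hS', h'⟩ := DxGood hO hS
    let pr : (i : Fin (m + 2)) → (Fin (m + 2) → E) →L[ℝ] E := fun i =>
      ContinuousLinearMap.proj (R := ℝ) (φ := fun _ : Fin (m + 2) => E) i
    refine ⟨fun w => (fderiv ℝ Λ (w 0) (w 1)) (w (Fin.last _)) + S' w, ?_, ?_⟩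
    · refine ContDiffOn.add ?_ hS'
      refine ContDiffOn.clm_apply (ContDiffOn.clm_apply ?_ (pr 1).contDiff.contDiffOn) (pr _).contDiff.contDiffOn
      exact (fd_smooth hO hΛ).comp (pr 0).contDiff.contDiffOn (fun w hw => hw)
    · intro V u hV hu hm T hT z hz
      have h1 := h V u hV hu hm T hT
      rw [Function.iterate_succ_apply', Dx_congr hV h1 hz]
      have hdS : DifferentiableAt ℝ (fun z => S (jet m u z)) z := 
        DifferentiableAt.comp z (smooth_diff (OO_open m hO) hS (hm hz)) (jet_diff hV hu m hz).differentiableAt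
      have hdu : DifferentiableAt ℝ u z := smooth_diff hV hu hz
      have hdΛ' : DifferentiableAt ℝ Λ (u z) := smooth_diff hO hΛ (hm hz)
      have hdΛ : DifferentiableAt ℝ (fun z => Λ (u z)) z := hdΛ'.comp z hdu
      have hdm : DifferentiableAt ℝ (Dx^[m + 1] u) z := smooth_diff hV (Dxi_smooth hV hu _) hz
      have h2 := h' V u hV hu hm _ (fun _ _ => rfl) hz
      have e1 : fderiv ℝ (fun z => Λ (u z)) z (1, 0) = fderiv ℝ Λ (u z) (Dx u z) := by
        show fderiv ℝ (Λ ∘ u) z (1, 0) = _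
        rw [fderiv_comp z hdΛ' hdu]; rfl
      show fderiv ℝ (fun z => Λ (u z) (Dx^[m + 1] u z) + S (jet m u z)) z (1, 0) = _
      rw [fderiv_fun_add (hdΛ.clm_apply hdm) hdS, fderiv_clm_apply hdΛ hdm]
      rw [ContinuousLinearMap.add_apply, ContinuousLinearMap.add_apply, ContinuousLinearMap.comp_apply,
        ContinuousLinearMap.flip_apply, e1, add_assoc]
      congr 1
      · rw [Function.iterate_succ_apply' Dx (m + 1)]; rfl
      · congr 1

end jets

end

section
open Set
open scoped Topology

lemma Jsmooth {J : E4 → E4 →L[ℝ] E4} (hJ : IsAlmostComplex J) : ContDiff ℝ (⊤ : ℕ∞) J :=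
  contDiff_iff_contDiffAt.2 fun p => (hJ.1 p).contDiffAt

lemma disk_Dy {J : E4 → E4 →L[ℝ] E4} {V : Set E2} {u : E2 → E4} (h : IsJHolDisk J V u) :
    EqOn (Dy u) (fun z => J (u z) (Dx u z)) V := by
  intro z hz
  have := congrArg (fun L => L (1, 0)) (h.2.2.2 z hz)
  have e : J0 (1, 0) = (0, 1) := by simp [J0]
  simp only [ContinuousLinearMap.comp_apply, e] at this
  exact this

lemma GG {J : E4 → E4 →L[ℝ] E4} (hJ : IsAlmostComplex J) (i : ℕ) :
    ∃ G : (Fin (i + 2) → E4) → E4, ContDiff ℝ (⊤ : ℕ∞) G ∧ ∀ V u, IsJHolDisk J V u →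
      EqOn (Dx^[i] (Dy u)) (fun z => G (jet (i + 1) u z)) V := by
  induction i with
  | zero =>
    let pr : (i : Fin 2) → (Fin 2 → E4) →L[ℝ] E4 := fun i =>
      ContinuousLinearMap.proj (R := ℝ) (φ := fun _ : Fin 2 => E4) i
    refine ⟨fun w => J (w 0) (w 1), ?_, ?_⟩
    · exact ((Jsmooth hJ).comp (pr 0).contDiff).clm_apply (pr 1).contDiff
    · intro V u h z hz
      exact disk_Dy h hz
  | succ i ih =>
    obtain ⟨G, hG, h⟩ := ih
    obtain ⟨G', hG', h'⟩ := DxGood (O := univ) isOpen_univ (m := i + 1) hG.contDiffOn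
    refine ⟨G', ?_, ?_⟩
    · rw [← contDiffOn_univ]
      exact hG'
    · intro V u hd
      rw [Function.iterate_succ_apply']
      exact h' V u hd.1 hd.2.2.1 (mapsTo_univ _ _) _ (h V u hd)

lemma FGood {J : E4 → E4 →L[ℝ] E4} (hJ : IsAlmostComplex J) {F : Type} [NormedAddCommGroup F]
    [NormedSpace ℝ F] {O : Set E4} (hO : IsOpen O) {m : ℕ} {Φ : (Fin (m + 1) → E4) → F}
    (hΦ : ContDiffOn ℝ (⊤ : ℕ∞) Φ (OO m O)) :
    ∃ Φ' : (Fin (m + 2) → E4) → (E2 →L[ℝ] F), ContDiffOn ℝ (⊤ : ℕ∞) Φ' (OO (m + 1) O) ∧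
      ∀ (V : Set E2) (u : E2 → E4), IsJHolDisk J V u → MapsTo u V O →
        ∀ T : E2 → F, EqOn T (fun z => Φ (jet m u z)) V →
          EqOn (fderiv ℝ T) (fun z => Φ' (jet (m + 1) u z)) V := by
  choose G hG hGe using GG hJ
  let rs : (i : Fin (m + 1)) → (Fin (m + 2) → E4) →L[ℝ] (Fin (i + 2) → E4) := fun i =>
    ContinuousLinearMap.pi fun j => ContinuousLinearMap.proj (R := ℝ) (φ := fun _ : Fin (m + 2) => E4)
      (Fin.castLE (by omega) j)
  let Y : (Fin (m + 2) → E4) → (Fin (m + 1) → E4) := fun w i => G i (rs i w)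
  have hY : ContDiff ℝ (⊤ : ℕ∞) Y := contDiff_pi.2 fun i => (hG i).comp (rs i).contDiff
  have hin : ContDiffOn ℝ (⊤ : ℕ∞) (initL (E := E4) m) (OO (m + 1) O) :=
    (ContinuousLinearMap.contDiff (initL (E := E4) m)).contDiffOn
  have hta : ContDiffOn ℝ (⊤ : ℕ∞) (tailL (E := E4) m) (OO (m + 1) O) :=
    (ContinuousLinearMap.contDiff (tailL (E := E4) m)).contDiffOn
  have hD : ContDiffOn ℝ (⊤ : ℕ∞) (fun w => fderiv ℝ Φ (initL m w)) (OO (m + 1) O) :=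
    (fd_smooth (OO_open m hO) hΦ).comp hin (initL_maps m O)
  let sx : F →L[ℝ] (E2 →L[ℝ] F) := ContinuousLinearMap.smulRightL ℝ E2 F (ContinuousLinearMap.fst ℝ ℝ ℝ)
  let sy : F →L[ℝ] (E2 →L[ℝ] F) := ContinuousLinearMap.smulRightL ℝ E2 F (ContinuousLinearMap.snd ℝ ℝ ℝ)
  refine ⟨fun w => sx (fderiv ℝ Φ (initL m w) (tailL m w)) + sy (fderiv ℝ Φ (initL m w) (Y w)), ?_, ?_⟩
  · refine ContDiffOn.add (sx.contDiff.comp_contDiffOn ?_) (sy.contDiff.comp_contDiffOn ?_)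
    · exact hD.clm_apply hta
    · exact hD.clm_apply hY.contDiffOn
  · intro V u hu hm T hT z hz
    have hV := hu.1
    have hs := hu.2.2.1
    have hT' : T =ᶠ[𝓝 z] Φ ∘ jet m u := Filter.eventuallyEq_of_mem (hV.mem_nhds hz) hT
    have hd : DifferentiableAt ℝ Φ (jet m u z) := smooth_diff (OO_open m hO) hΦ (hm hz)
    have hy : fderiv ℝ (jet m u) z (0, 1) = Y (jet (m + 1) u z) := by
      rw [(jet_diff hV hs m hz).fderiv]
      funext i
      show Dy (Dx^[(i : ℕ)] u) z = G i (jet (i + 1) u z)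
      rw [DxiDy hV hs i hz, hGe i V u hu hz]
    rw [hT'.fderiv_eq, fderiv_comp z hd (jet_diff hV hs m hz).differentiableAt]
    ext1
    · ext1
      show fderiv ℝ Φ (jet m u z) (fderiv ℝ (jet m u) z (1, 0)) = 
        (1:ℝ) • fderiv ℝ Φ (jet m u z) (Fin.tail (jet (m + 1) u z)) + (0:ℝ) • _
      rw [jet_Dx hV hs m hz]; simp
    · ext1
      show fderiv ℝ Φ (jet m u z) (fderiv ℝ (jet m u) z (0, 1)) = 
        (0:ℝ) • _ + (1:ℝ) • fderiv ℝ Φ (jet m u z) (Y (jet (m + 1) u z))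
      rw [hy]; simp

lemma iterGood {J : E4 → E4 →L[ℝ] E4} (hJ : IsAlmostComplex J) {O : Set E4} (hO : IsOpen O)
    {ρ : E4 → ℝ} (hρ : ContDiffOn ℝ (⊤ : ℕ∞) ρ O) (i : ℕ) :
    ∃ Φ : (Fin (i + 1) → E4) → (E2 [×i]→L[ℝ] ℝ), ContDiffOn ℝ (⊤ : ℕ∞) Φ (OO i O) ∧
      ∀ (V : Set E2) (u : E2 → E4), IsJHolDisk J V u → MapsTo u V O →
          EqOn (iteratedFDeriv ℝ i (fun z => ρ (u z))) (fun z => Φ (jet i u z)) V := by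
  induction i with
  | zero =>
    let L := (continuousMultilinearCurryFin0 ℝ E2 ℝ).symm
    refine ⟨fun w => L (ρ (w 0)), ?_, ?_⟩
    · exact L.contDiff.comp_contDiffOn (hρ.comp
        (ContinuousLinearMap.proj (R := ℝ) (φ := fun _ : Fin 1 => E4) 0).contDiff.contDiffOn (fun w hw => hw))
    · intro V u hu hm z hz
      rw [iteratedFDeriv_zero_eq_comp]; rfl
  | succ i ih =>
    obtain ⟨Φ, hΦ, h⟩ := ih
    obtain ⟨Φ', hΦ', h'⟩ := FGood hJ hO hΦ
    let L : (E2 →L[ℝ] (E2 [×i]→L[ℝ] ℝ)) ≃ₗᵢ[ℝ] (E2 [×(i + 1)]→L[ℝ] ℝ) :=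
      (continuousMultilinearCurryLeftEquiv ℝ (fun _ : Fin (i + 1) => E2) ℝ).symm
    have hL : ContDiff ℝ (⊤ : ℕ∞) (fun x => L x) := by apply LinearIsometryEquiv.contDiff
    refine ⟨fun w => L (Φ' w), hL.comp_contDiffOn hΦ', ?_⟩
    intro V u hu hm z hz
    have := h' V u hu hm _ (h V u hu hm) hz
    rw [iteratedFDeriv_succ_eq_comp_left]
    show L (fderiv ℝ _ z) = _
    rw [this]

end

section
open Set
open scoped Topology

lemma van_fd {V : Set E2} (hV : IsOpen V) (h0 : (0 : E2) ∈ V) {f : E2 → ℝ}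
    (hf : ContDiffOn ℝ (⊤ : ℕ∞) f V) {k : ℕ} (h : VanishesToOrder f (k + 1)) (v : E2) :
    VanishesToOrder (fun z => fderiv ℝ f z v) k := by
  intro i hi
  have h1 : iteratedFDeriv ℝ i (fderiv ℝ f) 0 = 0 := by
    rw [← norm_eq_zero, norm_iteratedFDeriv_fderiv, h (i + 1) (by omega), norm_zero]
  have h2 : ContDiffAt ℝ (⊤ : ℕ∞) (fderiv ℝ f) 0 := (fd_smooth hV hf).contDiffAt (hV.mem_nhds h0)
  have h3 := (ContinuousLinearMap.apply ℝ ℝ v).iteratedFDeriv_comp_left h2 (i := i)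
    (by exact_mod_cast le_top)
  rw [h1] at h3
  show iteratedFDeriv ℝ i ((ContinuousLinearMap.apply ℝ ℝ v) ∘ (fderiv ℝ f)) 0 = 0
  rw [h3]; ext; simp

lemma van_Dxi {V : Set E2} (hV : IsOpen V) (h0 : (0 : E2) ∈ V) {f : E2 → ℝ}
    (hf : ContDiffOn ℝ (⊤ : ℕ∞) f V) {k i : ℕ} (h : VanishesToOrder f (k + 1)) (hi : i ≤ k) :
    Dx^[i] f 0 = 0 := by
  have : VanishesToOrder (Dx^[i] f) (k + 1 - i) := by
    induction i with
    | zero => exact h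
    | succ i ih =>
      rw [Function.iterate_succ_apply']
      have ih' := ih (by omega)
      have e : k + 1 - i = (k + 1 - (i + 1)) + 1 := by omega
      rw [e] at ih'
      exact van_fd hV h0 (Dxi_smooth hV hf i) ih' (1, 0)
  have h1 := this 0 (by omega)
  have h2 : ‖iteratedFDeriv ℝ 0 (Dx^[i] f) 0‖ = 0 := by rw [h1, norm_zero]
  rwa [norm_iteratedFDeriv_zero, norm_eq_zero] at h2

lemma van_DxiDy {V : Set E2} (hV : IsOpen V) (h0 : (0 : E2) ∈ V) {f : E2 → ℝ}
    (hf : ContDiffOn ℝ (⊤ : ℕ∞) f V) {k i : ℕ} (h : VanishesToOrder f (k + 1)) (hi : i + 1 ≤ k) :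
    Dx^[i] (Dy f) 0 = 0 := by
  obtain ⟨k, rfl⟩ : ∃ k', k = k' + 1 := ⟨k - 1, by omega⟩
  exact van_Dxi hV h0 (Dy_smooth hV hf) (van_fd hV h0 hf h (0, 1)) (by omega)

lemma van_comp {V : Set E2} (hV : IsOpen V) (h0 : (0 : E2) ∈ V) {f : E2 → ℝ}
    (hf : ContDiffOn ℝ (⊤ : ℕ∞) f V) {k : ℕ} (h : VanishesToOrder f k) {φ : E2 → E2}
    (hφ : ContDiff ℝ (⊤ : ℕ∞) φ) (hφ0 : φ 0 = 0) : VanishesToOrder (fun z => f (φ z)) k := by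
  intro n hn
  have hW : IsOpen (φ ⁻¹' V) := hV.preimage hφ.continuous
  have hW0 : (0 : E2) ∈ φ ⁻¹' V := by simpa [hφ0] using h0
  let D : ℝ := 1 + ∑ i ∈ Finset.range (n + 1), ‖iteratedFDerivWithin ℝ i φ (φ ⁻¹' V) 0‖
  have hD1 : 1 ≤ D := by
    have : 0 ≤ ∑ i ∈ Finset.range (n + 1), ‖iteratedFDerivWithin ℝ i φ (φ ⁻¹' V) 0‖ :=
      Finset.sum_nonneg fun _ _ => norm_nonneg _
    simp only [D]; linarith
  have := norm_iteratedFDerivWithin_comp_le (n := n) hf hφ.contDiffOn (by exact_mod_cast le_top)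
    hV.uniqueDiffOn hW.uniqueDiffOn (fun z hz => hz) hW0 (C := 0) (D := D) (by
      intro i hi
      rw [hφ0, iteratedFDerivWithin_of_isOpen i hV h0, h i (by omega), norm_zero]) (by
      intro i h1 hi
      refine le_trans ?_ (le_self_pow₀ hD1 (by omega))
      have := Finset.single_le_sum (f := fun i => ‖iteratedFDerivWithin ℝ i φ (φ ⁻¹' V) 0‖)
        (fun _ _ => norm_nonneg _) (Finset.mem_range.2 (show i < n + 1 by omega))
      simp only [D]
      linarith)
  rw [iteratedFDerivWithin_of_isOpen n hW hW0, mul_zero, zero_mul] at this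
  exact norm_le_zero_iff.1 this

/- holomorphic polynomial maps -/
def ec : ℂ ≃L[ℝ] E2 := Complex.equivRealProdCLM

def pol (P : Polynomial ℂ) : E2 → E2 := fun z => ec (P.eval (ec.symm z))

def mulC (c : ℂ) : E2 →L[ℝ] E2 :=
  (ec : ℂ →L[ℝ] E2).comp ((ContinuousLinearMap.mul ℝ ℂ c).comp (ec.symm : E2 →L[ℝ] ℂ))

lemma mulC_apply (c : ℂ) (v : E2) : mulC c v = ec (c * ec.symm v) := rfl

lemma pol_hd (P : Polynomial ℂ) (z : E2) :
    HasFDerivAt (pol P) (mulC (P.derivative.eval (ec.symm z))) z := by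
  have h1 := (P.hasDerivAt (ec.symm z)).complexToReal_fderiv
  have h2 := (ec : ℂ →L[ℝ] E2).hasFDerivAt.comp z (h1.comp z (ec.symm : E2 →L[ℝ] ℂ).hasFDerivAt)
  refine h2.congr_fderiv ?_
  ext1 <;> ext1 <;> simp [mulC]

lemma pol_smooth (P : Polynomial ℂ) : ContDiff ℝ (⊤ : ℕ∞) (pol P) := by
  refine ec.contDiff.comp (ContDiff.comp (g := fun c : ℂ => P.eval c) ?_ ec.symm.contDiff)
  exact (P.differentiable.contDiff (n := (⊤ : ℕ∞))).restrict_scalars ℝ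

lemma J0_ec (c : ℂ) : J0 (ec c) = ec (Complex.I * c) := by
  ext <;> simp [J0, ec]

lemma ec_symm_J0 (v : E2) : ec.symm (J0 v) = Complex.I * ec.symm v := by
  obtain ⟨c, rfl⟩ := ec.surjective v
  rw [J0_ec]; simp

lemma mulC_J0 (c : ℂ) : (mulC c).comp J0 = J0.comp (mulC c) := by
  ext1 <;> ext1 <;>
  simp only [ContinuousLinearMap.comp_apply, mulC_apply, J0_ec, ec_symm_J0] <;> ring_nf

lemma ec_symm_one : ec.symm (1, 0) = 1 := by
  rw [ContinuousLinearEquiv.symm_apply_eq]; ext <;> simp [ec]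

lemma pol_Dx (P : Polynomial ℂ) : Dx (pol P) = pol P.derivative := by
  funext z
  rw [Dx, (pol_hd P z).fderiv, mulC_apply, ec_symm_one, mul_one]; rfl

lemma pol_Dxi (P : Polynomial ℂ) (i : ℕ) : Dx^[i] (pol P) = pol (Polynomial.derivative^[i] P) := by
  induction i with
  | zero => rfl
  | succ i ih => rw [Function.iterate_succ_apply', ih, pol_Dx, Function.iterate_succ_apply']

lemma pol_jet (P : Polynomial ℂ) (i : ℕ) : Dx^[i] (pol P) 0 = ec (i.factorial * P.coeff i) := by
  rw [pol_Dxi]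
  simp only [pol, map_zero]
  rw [← Polynomial.coeff_zero_eq_eval_zero, Polynomial.coeff_iterate_derivative]
  simp [Nat.descFactorial_self]

lemma pol_zero {P : Polynomial ℂ} (h : P.coeff 0 = 0) : pol P 0 = 0 := by
  simp only [pol, map_zero]
  rw [← Polynomial.coeff_zero_eq_eval_zero, h, map_zero]

lemma pol_X : pol Polynomial.X = id := by
  funext z; simp [pol]

lemma pullback {J : E4 → E4 →L[ℝ] E4} {V : Set E2} {γ : E2 → E4} (h : IsJHolDisk J V γ)
    {P : Polynomial ℂ} (hP : P.coeff 0 = 0) :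
    IsJHolDisk J (pol P ⁻¹' V) (fun z => γ (pol P z)) := by
  refine ⟨h.1.preimage (pol_smooth P).continuous, by simpa [pol_zero hP] using h.2.1,
    h.2.2.1.comp (pol_smooth P).contDiffOn (fun z hz => hz), fun z hz => ?_⟩
  have hd : HasFDerivAt γ (fderiv ℝ γ (pol P z)) (pol P z) := (smooth_diff h.1 h.2.2.1 hz).hasFDerivAt
  have := hd.comp z (pol_hd P z)
  have e : fderiv ℝ (fun z => γ (pol P z)) z = _ := this.fderiv
  rw [e, ContinuousLinearMap.comp_assoc, mulC_J0, ← ContinuousLinearMap.comp_assoc, h.2.2.2 _ hz,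
    ContinuousLinearMap.comp_assoc]

lemma fd_ec {J : E4 → E4 →L[ℝ] E4} {V : Set E2} {γ : E2 → E4} (h : IsJHolDisk J V γ) (c : ℂ) :
    fderiv ℝ γ 0 (ec c) = c.re • Dx γ 0 + c.im • J (γ 0) (Dx γ 0) := by
  have h1 : ec c = c.re • ((1, 0) : E2) + c.im • ((0, 1) : E2) := by ext <;> simp [ec]
  rw [h1, map_add, map_smul, map_smul]
  congr 2
  exact disk_Dy h h.2.1

lemma pullback_Dx {J : E4 → E4 →L[ℝ] E4} {V : Set E2} {γ : E2 → E4} (h : IsJHolDisk J V γ)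
    {P : Polynomial ℂ} (hP : P.coeff 0 = 0) :
    EqOn (Dx (fun z => γ (pol P z))) (fun z => fderiv ℝ γ (pol P z) (Dx (pol P) z)) (pol P ⁻¹' V) := by
  intro z hz
  have hd : HasFDerivAt γ (fderiv ℝ γ (pol P z)) (pol P z) := (smooth_diff h.1 h.2.2.1 hz).hasFDerivAt
  have := hd.comp z (pol_hd P z)
  have e : fderiv ℝ (fun z => γ (pol P z)) z = _ := this.fderiv
  show fderiv ℝ (fun z => γ (pol P z)) z (1, 0) = fderiv ℝ γ (pol P z) (fderiv ℝ (pol P) z (1, 0))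
  rw [e, (pol_hd P z).fderiv]; rfl

lemma reparam {J : E4 → E4 →L[ℝ] E4} {V : Set E2} {γ : E2 → E4} (h : IsJHolDisk J V γ)
    (m : ℕ) (hm : 1 ≤ m) (a : ℂ) : ∃ P : Polynomial ℂ, P.coeff 0 = 0 ∧
      (∀ i ≤ m, Dx^[i] (fun z => γ (pol P z)) 0 = Dx^[i] γ 0) ∧
      Dx^[m + 1] (fun z => γ (pol P z)) 0 = Dx^[m + 1] γ 0 + fderiv ℝ γ 0 (ec a) := by
  let P : Polynomial ℂ := Polynomial.X + Polynomial.C (a / (m + 1).factorial) * Polynomial.X ^ (m + 1)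
  have hP0 : P.coeff 0 = 0 := by simp [P]
  have hcoef : ∀ i ≤ m, P.coeff i = (Polynomial.X : Polynomial ℂ).coeff i := by
    intro i hi
    simp only [P, Polynomial.coeff_add, Polynomial.coeff_C_mul, Polynomial.coeff_X_pow]
    rw [if_neg (by omega)]; simp
  have hcoef' : P.coeff (m + 1) = a / (m + 1).factorial := by
    simp only [P, Polynomial.coeff_add, Polynomial.coeff_C_mul, Polynomial.coeff_X_pow, Polynomial.coeff_X]
    rw [if_neg (by omega)]; simp
  have key : ∀ i, Dx^[i + 1] (fun z => γ (pol P z)) 0 - fderiv ℝ γ 0 (Dx^[i + 1] (pol P) 0) 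
      = Dx^[i + 1] γ 0 - fderiv ℝ γ 0 (Dx^[i + 1] (pol Polynomial.X) 0) ∨ m < i := by
    intro i
    by_cases hi : m < i
    · exact Or.inr hi
    left
    obtain ⟨S, hS, hSe⟩ := leading h.1 (fd_smooth h.1 h.2.2.1) i
    have e1 := hSe (pol P ⁻¹' V) (pol P) (pullback h hP0).1 (pol_smooth P).contDiffOn (fun z hz => hz)
      _ (pullback_Dx h hP0) (pullback h hP0).2.1
    have e2 := hSe (pol Polynomial.X ⁻¹' V) (pol Polynomial.X) (pullback h (by simp)).1
      (pol_smooth _).contDiffOn (fun z hz => hz)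
      _ (pullback_Dx h (by simp)) (pullback h (by simp)).2.1
    have ej : jet i (pol P) 0 = jet i (pol Polynomial.X) 0 := by
      funext l
      simp only [jet, pol_jet]
      rw [hcoef l (by omega)]
    rw [← Function.iterate_succ_apply] at e1 e2
    simp only [pol_zero hP0] at e1
    simp only [pol_zero Polynomial.coeff_X_zero] at e2
    simp only [Nat.succ_eq_add_one] at e1 e2
    rw [e1]
    have : (fun z => γ (pol Polynomial.X z)) = γ := by rw [pol_X]; rfl
    rw [this] at e2
    rw [e2, ej]
    abel
  refine ⟨P, hP0, ?_, ?_⟩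
  · intro i hi
    rcases i with _ | i
    · simp [pol_zero hP0]
    · have := (key i).resolve_right (by omega)
      rw [pol_jet, pol_jet, hcoef _ hi] at this
      exact sub_left_injective this
  · have := (key m).resolve_right (by omega)
    rw [pol_jet, pol_jet, hcoef', Polynomial.coeff_X, if_neg (by omega), mul_zero, map_zero, map_zero,
      sub_zero, sub_eq_iff_eq_add, mul_div_cancel₀] at this
    · exact this
    · exact_mod_cast (Nat.factorial_pos _).ne'

end

section
open Set
open scoped Topology

lemma disk_mono {J : E4 → E4 →L[ℝ] E4} {V W : Set E2} {γ : E2 → E4} (h : IsJHolDisk J V γ)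
    (hW : IsOpen W) (h0 : (0 : E2) ∈ W) (hWV : W ⊆ V) : IsJHolDisk J W γ :=
  ⟨hW, h0, h.2.2.1.mono hWV, fun z hz => h.2.2.2 z (hWV hz)⟩

lemma disk_into {J : E4 → E4 →L[ℝ] E4} {V : Set E2} {γ : E2 → E4} (h : IsJHolDisk J V γ)
    {Ω : Set E4} (hΩ : IsOpen Ω) (h0 : γ 0 ∈ Ω) :
    IsJHolDisk J (V ∩ γ ⁻¹' Ω) γ :=
  disk_mono h (h.2.2.1.continuousOn.isOpen_inter_preimage h.1 hΩ) ⟨h.2.1, h0⟩ inter_subset_left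

lemma disk_regular {J : E4 → E4 →L[ℝ] E4} {V : Set E2} {γ : E2 → E4} (h : IsJHolDisk J V γ)
    (h0 : Dx γ 0 ≠ 0) : ∃ W ⊆ V, IsJHolDisk J W γ ∧ IsRegularOn γ W := by
  have hc : ContinuousOn (Dx γ) V := (Dx_smooth h.1 h.2.2.1).continuousOn
  refine ⟨V ∩ Dx γ ⁻¹' {0}ᶜ, inter_subset_left, disk_mono h (hc.isOpen_inter_preimage h.1 isOpen_compl_singleton)
    ⟨h.2.1, h0⟩ inter_subset_left, ?_⟩
  intro z hz he
  apply hz.2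
  simp [Dx, he]

lemma regular_Dx {J : E4 → E4 →L[ℝ] E4} {V : Set E2} {γ : E2 → E4} (h : IsJHolDisk J V γ)
    (h0 : fderiv ℝ γ 0 ≠ 0) : Dx γ 0 ≠ 0 := by
  intro he
  apply h0
  have h2 := disk_Dy h h.2.1
  simp only [he, map_zero] at h2
  ext1 <;> ext1
  · exact he
  · exact h2

lemma proj_exists (a b w : E4) : ∃ α β : ℝ, inner ℝ a (w + (α • a + β • b)) = 0 ∧
    inner ℝ b (w + (α • a + β • b)) = 0 := by
  let K : Submodule ℝ E4 := Submodule.span ℝ {a, b}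
  have h1 : K.starProjection w ∈ K := Submodule.starProjection_apply_mem K w
  obtain ⟨α, β, h⟩ := Submodule.mem_span_pair.1 h1
  have h2 : w - K.starProjection w ∈ Kᗮ := Submodule.sub_starProjection_mem_orthogonal w
  have e : w + ((-α) • a + (-β) • b) = w - K.starProjection w := by rw [← h]; module
  refine ⟨-α, -β, ?_, ?_⟩
  · rw [e]; exact Submodule.inner_right_of_mem_orthogonal (Submodule.subset_span (by simp)) h2
  · rw [e]; exact Submodule.inner_right_of_mem_orthogonal (Submodule.subset_span (by simp)) h2

def NrmD (J : E4 → E4 →L[ℝ] E4) (ρ : E4 → ℝ) (Ω : Set E4) (k N : ℕ) (z : E4) (V : Set E2) (γ : E2 → E4) : Prop :=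
  IsJHolDisk J V γ ∧ MapsTo γ V Ω ∧ γ 0 = z ∧ ‖Dx γ 0‖ = 1 ∧
    VanishesToOrder (fun ζ => ρ (γ ζ)) (k + 1) ∧ ∀ m, 2 ≤ m → m ≤ N →
      inner ℝ (Dx γ 0) (Dx^[m] γ 0) = 0 ∧ inner ℝ (J z (Dx γ 0)) (Dx^[m] γ 0) = 0

lemma van_pull {J : E4 → E4 →L[ℝ] E4} {ρ : E4 → ℝ} {Ω : Set E4} 
    (hρ : ContDiffOn ℝ (⊤ : ℕ∞) ρ Ω) {k : ℕ} {V : Set E2} {γ : E2 → E4} (h : IsJHolDisk J V γ)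
    (hm : MapsTo γ V Ω) (hv : VanishesToOrder (fun ζ => ρ (γ ζ)) (k + 1)) {P : Polynomial ℂ}
    (hP : P.coeff 0 = 0) : VanishesToOrder (fun ζ => ρ (γ (pol P ζ))) (k + 1) :=
  van_comp h.1 h.2.1 (hρ.comp h.2.2.1 hm) hv (pol_smooth P) (pol_zero hP)

lemma nrm_exists {J : E4 → E4 →L[ℝ] E4} {ρ : E4 → ℝ} {Ω : Set E4} (hΩ : IsOpen Ω)
    (hρ : ContDiffOn ℝ (⊤ : ℕ∞) ρ Ω) {k : ℕ} {z : E4} (hz : z ∈ Ω) {V : Set E2} {γ : E2 → E4}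
    (h : IsJHolDisk J V γ) (hr : IsRegularOn γ V) (h0 : γ 0 = z)
    (hv : VanishesToOrder (fun ζ => ρ (γ ζ)) (k + 1)) (N : ℕ) :
    ∃ V' γ', NrmD J ρ Ω k (N + 1) z V' γ' := by
  induction N with
  | zero =>
    have h' := disk_into h hΩ (by rw [h0]; exact hz)
    have hm : MapsTo γ (V ∩ γ ⁻¹' Ω) Ω := fun x hx => hx.2
    have hx : Dx γ 0 ≠ 0 := regular_Dx h (hr 0 h.2.1)
    have hn : ‖Dx γ 0‖ ≠ 0 := norm_ne_zero_iff.2 hx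
    let P : Polynomial ℂ := Polynomial.C (((‖Dx γ 0‖⁻¹ : ℝ)) : ℂ) * Polynomial.X
    have hP0 : P.coeff 0 = 0 := by simp [P]
    have hp := pullback h' hP0
    refine ⟨_, _, hp, fun x hx => hm hx, ?_, ?_, van_pull hρ h' hm hv hP0, ?_⟩
    · simp [pol_zero hP0, h0]
    · rw [pullback_Dx h' hP0 hp.2.1]
      beta_reduce
      rw [pol_zero hP0]
      have : Dx (pol P) 0 = Dx^[1] (pol P) 0 := rfl
      rw [this, pol_jet, fd_ec h']
      simp [P, norm_smul, hn]
    · intro m h1 h2; omega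
  | succ N ih =>
    obtain ⟨V, γ, h1, h2, h3, h4, h5, h6⟩ := ih
    obtain ⟨α, β, hα, hβ⟩ := proj_exists (Dx γ 0) (J z (Dx γ 0)) (Dx^[N + 2] γ 0)
    obtain ⟨P, hP0, hlow, htop⟩ := reparam h1 (N + 1) (by omega) ⟨α, β⟩
    have hD1 : Dx (fun z => γ (pol P z)) 0 = Dx γ 0 := hlow 1 (by omega)
    have hp := pullback h1 hP0
    refine ⟨_, _, hp, fun x hx => h2 hx, ?_, ?_, van_pull hρ h1 h2 h5 hP0, ?_⟩
    · simp [pol_zero hP0, h3]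
    · rw [hD1, h4]
    · intro m hm1 hm2
      rw [hD1]
      rcases Nat.lt_or_ge m (N + 2) with hlt | hge
      · rw [hlow m (by omega)]
        exact h6 m hm1 (by omega)
      · obtain rfl : m = N + 2 := by omega
        rw [htop, fd_ec h1, h3]
        exact ⟨hα, hβ⟩

def tay (M : ℕ) (l : ℕ → E4) (x : ℝ) : E4 := ∑ j ∈ Finset.range M, (x ^ j / j.factorial) • l j

lemma tay_deriv (M : ℕ) (l : ℕ → E4) (x : ℝ) :
    HasDerivAt (tay (M + 1) l) (tay M (fun j => l (j + 1)) x) x := by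
  have e : tay (M + 1) l = fun x : ℝ => ∑ j ∈ Finset.range M, (x ^ (j + 1) / (j + 1).factorial) • l (j + 1) + l 0 := by
    funext x; rw [tay, Finset.sum_range_succ']; simp
  rw [e]
  refine HasDerivAt.add_const _ (HasDerivAt.fun_sum fun j _ => ?_)
  refine HasDerivAt.smul_const ?_ _
  have := (hasDerivAt_pow (j + 1) x).div_const ((j + 1).factorial : ℝ)
  refine this.congr_deriv ?_
  rw [Nat.factorial_succ]
  have : (j.factorial : ℝ) ≠ 0 := by exact_mod_cast (Nat.factorial_pos _).ne'
  push_cast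
  field_simp

lemma tay_zero (M : ℕ) (l : ℕ → E4) : tay (M + 1) l 0 = l 0 := by
  rw [tay, Finset.sum_range_succ']; simp

lemma tay_jet {V : Set E2} (hV : IsOpen V) (h0 : (0 : E2) ∈ V) (n : ℕ) : ∀ (M : ℕ) (l : ℕ → E4) (u : E2 → E4),
    ContDiffOn ℝ (⊤ : ℕ∞) u V → (∀ x : ℝ, ((x, 0) : E2) ∈ V → u (x, 0) = tay (M + n + 1) l x) →
    Dx^[n] u 0 = l n := by
  induction n with
  | zero =>
    intro M l u hu h
    have := h 0 h0
    rw [tay_zero] at this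
    exact this
  | succ n ih =>
    intro M l u hu h
    rw [Function.iterate_succ_apply]
    refine ih M (fun j => l (j + 1)) (Dx u) (Dx_smooth hV hu) fun x hx => ?_
    have hd : HasFDerivAt u (fderiv ℝ u (x, 0)) (x, 0) := (smooth_diff hV hu hx).hasFDerivAt
    have hc : HasDerivAt (fun t : ℝ => ((t, 0) : E2)) (1, 0) x := (hasDerivAt_id x).prodMk (hasDerivAt_const x 0)
    have h1 : HasDerivAt (fun t : ℝ => u (t, 0)) (fderiv ℝ u (x, 0) (1, 0)) x := hd.comp_hasDerivAt x hc
    have h2 := tay_deriv (M + n + 1) l x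
    have ev : (fun t : ℝ => u (t, 0)) =ᶠ[𝓝 x] tay (M + n + 1 + 1) l := by
      have : ∀ᶠ t in 𝓝 x, ((t, 0) : E2) ∈ V := hc.continuousAt.eventually (hV.mem_nhds hx)
      filter_upwards [this] with t ht using h t ht
    exact h1.unique (h2.congr_of_eventuallyEq ev)

lemma CK_jet {J : E4 → E4 →L[ℝ] E4} (hJ : IsAlmostComplex J) (l : ℕ → E4) (K : ℕ) :
    ∃ V u, IsJHolDisk J V u ∧ ∀ i ≤ K, Dx^[i] u 0 = l i := by
  obtain ⟨V, u, hd, h⟩ := CK hJ (l 0) (fun i => ((i + 1).factorial : ℝ)⁻¹ • l (i + 1)) K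
  refine ⟨V, u, hd, fun i hi => ?_⟩
  obtain ⟨M, rfl⟩ := Nat.exists_eq_add_of_le' hi
  refine tay_jet hd.1 hd.2.1 i M l u hd.2.2.1 fun x hx => ?_
  rw [h x hx, tay, Finset.sum_range_succ', add_comm]
  congr 1
  · refine Finset.sum_congr rfl fun j _ => ?_
    rw [smul_smul]; rfl
  · simp

lemma lin_alg (j : E4 →L[ℝ] E4) (hj : ∀ v, j (j v) = -v) (l : E4 →L[ℝ] ℝ) (hl : l ≠ 0) (h : E4) (hh : h ≠ 0)
    (h1 : l h = 0) (h2 : l (j h) = 0) (v : E4) (v1 : l v = 0) (v2 : l (j v) = 0)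
    (v3 : inner ℝ h v = 0) (v4 : inner ℝ (j h) v = 0) : v = 0 := by
  let T : E4 →ₗ[ℝ] ℝ × ℝ := (l.prod (l.comp j)).toLinearMap
  have hT : ∀ x, T x = (l x, l (j x)) := fun x => rfl
  have hsurj : LinearMap.range T = ⊤ := by
    rw [LinearMap.range_eq_top]
    obtain ⟨w, hw⟩ : ∃ w, l w ≠ 0 := by
      by_contra hc; push Not at hc; exact hl (by ext1 x; simpa using hc x)
    rintro ⟨a, b⟩
    have hpos : l w * l w + l (j w) * l (j w) ≠ 0 := by
      have : 0 < l w * l w := mul_self_pos.2 hw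
      nlinarith [mul_self_nonneg (l (j w))]
    refine ⟨((a * l w + b * l (j w)) / (l w * l w + l (j w) * l (j w))) • w +
      ((a * l (j w) - b * l w) / (l w * l w + l (j w) * l (j w))) • j w, ?_⟩
    rw [hT]
    simp only [map_add, map_smul, hj, map_neg, smul_eq_mul]
    ext
    · simp only; field_simp; ring
    · simp only; field_simp; ring
  have hk : Module.finrank ℝ (LinearMap.ker T) = 2 := by
    have := T.finrank_range_add_finrank_ker
    rw [hsurj, finrank_top] at this
    simp at this
    omega
  let S : Submodule ℝ E4 := Submodule.span ℝ (Set.range ![h, j h])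
  have hli : LinearIndependent ℝ ![h, j h] := by
    rw [LinearIndependent.pair_iff]
    intro s t hst
    have hst2 : s • j h - t • h = 0 := by
      have := congrArg j hst
      simp only [map_add, map_smul, hj, map_zero] at this
      rw [← this]; module
    have : (s * s + t * t) • h = 0 := by
      have e : (s * s + t * t) • h = s • (s • h + t • j h) - t • (s • j h - t • h) := by module
      rw [e, hst, hst2]; simp
    have h3 := (smul_eq_zero.1 this).resolve_right hh
    constructor <;> nlinarith [mul_self_nonneg s, mul_self_nonneg t]
  have hS : Module.finrank ℝ S = 2 := by
    have := finrank_span_eq_card hli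
    simpa using this
  have hle : S ≤ LinearMap.ker T := by
    refine Submodule.span_le.2 ?_
    rintro x ⟨i, rfl⟩
    fin_cases i
    · simp [hT, h1, h2]
    · simp [hT, h1, h2, hj]
  have heq := Submodule.eq_of_le_of_finrank_eq hle (by rw [hS, hk])
  have hv : v ∈ S := by rw [heq]; simp [hT, v1, v2]
  have hv' : v ∈ Submodule.span ℝ {h, j h} := by
    rw [← Matrix.range_cons_cons_empty h (j h) ![]]
    exact hv
  obtain ⟨a, b, hab⟩ := Submodule.mem_span_pair.1 hv'
  have : inner ℝ v v = 0 := by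
    have e : inner ℝ v v = inner ℝ (a • h + b • j h) v := by rw [hab]
    rw [e, inner_add_left, inner_smul_left, inner_smul_left, v3, v4]; simp
  exact inner_self_eq_zero.1 this

lemma tendsto_of_L {ι G : Type} [NormedAddCommGroup G] [NormedSpace ℝ G] [FiniteDimensional ℝ G] {𝒰 : Filter ι}
    {L : ι → E4 →L[ℝ] G} {L0 : E4 →L[ℝ] G} (hL : Filter.Tendsto L 𝒰 (𝓝 L0))
    (hinj : ∀ v, L0 v = 0 → v = 0) {x : ι → E4} {b : G}
    (hx : Filter.Tendsto (fun i => L i (x i)) 𝒰 (𝓝 b)) : ∃ y, Filter.Tendsto x 𝒰 (𝓝 y) := by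
  obtain ⟨R, hR⟩ := LinearMap.exists_leftInverse_of_injective L0.toLinearMap (LinearMap.ker_eq_bot'.2 hinj)
  let R' : G →L[ℝ] E4 := R.toContinuousLinearMap
  have hR' : R'.comp L0 = 1 := by
    ext1 v
    exact congrArg (fun f : E4 →ₗ[ℝ] E4 => f v) hR
  have h1 : Filter.Tendsto (fun i => R'.comp (L i)) 𝒰 (𝓝 1) := by
    rw [← hR']
    exact ((ContinuousLinearMap.compL ℝ E4 G E4 R').continuous.tendsto L0).comp hL
  have h2 : Filter.Tendsto (fun i => Ring.inverse (R'.comp (L i))) 𝒰 (𝓝 (Ring.inverse 1)) :=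
    (NormedRing.inverse_continuousAt (1 : (E4 →L[ℝ] E4)ˣ)).tendsto.comp h1
  have h3 : Filter.Tendsto (fun i => R' (L i (x i))) 𝒰 (𝓝 (R' b)) := (R'.continuous.tendsto b).comp hx
  have hcont : Continuous (fun q : (E4 →L[ℝ] E4) × E4 => q.1 q.2) := continuous_fst.clm_apply continuous_snd
  have h5 := (hcont.tendsto (Ring.inverse 1, R' b)).comp (h2.prodMk_nhds h3)
  refine ⟨_, h5.congr' ?_⟩
  have h4 : ∀ᶠ i in 𝒰, IsUnit (R'.comp (L i)) := h1.eventually (Units.isOpen.mem_nhds isUnit_one)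
  filter_upwards [h4] with i hi
  exact congrArg (fun f : E4 →L[ℝ] E4 => f (x i)) (Ring.inverse_mul_cancel _ hi)

end

section
open Set
open scoped Topology

lemma fd_rho {ρ : E4 → ℝ} {Ω : Set E4} (hΩ : IsOpen Ω) (hρ : ContDiffOn ℝ (⊤ : ℕ∞) ρ Ω) :
    ContDiffOn ℝ (⊤ : ℕ∞) (fderiv ℝ ρ) Ω :=
  hρ.fderiv_of_isOpen hΩ (by simp)

lemma chain {V : Set E2} (hV : IsOpen V) {ρ : E4 → ℝ} {Ω : Set E4} (hΩ : IsOpen Ω) (hρ : ContDiffOn ℝ (⊤ : ℕ∞) ρ Ω)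
    {γ : E2 → E4} (hγ : ContDiffOn ℝ (⊤ : ℕ∞) γ V) (hm : MapsTo γ V Ω) {ζ : E2} (hζ : ζ ∈ V) (e : E2) :
    fderiv ℝ (fun z => ρ (γ z)) ζ e = fderiv ℝ ρ (γ ζ) (fderiv ℝ γ ζ e) := by
  have h1 : DifferentiableAt ℝ ρ (γ ζ) :=
    ((hρ.differentiableOn (by simp)) _ (hm hζ)).differentiableAt (hΩ.mem_nhds (hm hζ))
  have h2 : DifferentiableAt ℝ γ ζ := ((hγ.differentiableOn (by simp)) _ hζ).differentiableAt (hV.mem_nhds hζ)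
  have := fderiv_comp ζ h1 h2
  have h3 : fderiv ℝ (fun z => ρ (γ z)) ζ = (fderiv ℝ ρ (γ ζ)).comp (fderiv ℝ γ ζ) := this
  rw [h3]; rfl

lemma key1 {J : E4 → E4 →L[ℝ] E4} {ρ : E4 → ℝ} {Ω : Set E4} (hΩ : IsOpen Ω)
    (hρ : ContDiffOn ℝ (⊤ : ℕ∞) ρ Ω) {k N : ℕ} {z : E4} {V : Set E2} {γ : E2 → E4}
    (hk : 1 ≤ k) (h : NrmD J ρ Ω k N z V γ) :
    fderiv ℝ ρ z (Dx γ 0) = 0 ∧ fderiv ℝ ρ z (J z (Dx γ 0)) = 0 := by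
  obtain ⟨h1, h2, h3, h4, h5, h6⟩ := h
  have hf : ContDiffOn ℝ (⊤ : ℕ∞) (fun ζ => ρ (γ ζ)) V := hρ.comp h1.2.2.1 h2
  have a := van_Dxi h1.1 h1.2.1 hf h5 (i := 1) hk
  have b := van_DxiDy h1.1 h1.2.1 hf h5 (i := 0) (by omega)
  have a' := chain h1.1 hΩ hρ h1.2.2.1 h2 h1.2.1 (1, 0)
  have b' := chain h1.1 hΩ hρ h1.2.2.1 h2 h1.2.1 (0, 1)
  have c := disk_Dy h1 h1.2.1
  beta_reduce at c
  rw [h3] at a' b' c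
  constructor
  · exact a'.symm.trans a
  · rw [← c]; exact b'.symm.trans b

lemma key {J : E4 → E4 →L[ℝ] E4} (hJ : IsAlmostComplex J) {ρ : E4 → ℝ} {Ω : Set E4} (hΩ : IsOpen Ω)
    (hρ : ContDiffOn ℝ (⊤ : ℕ∞) ρ Ω) {k m : ℕ} (hm : m + 1 ≤ k) :
    ∃ S1 S2 : (Fin (m + 1) → E4) → ℝ, ContDiffOn ℝ (⊤ : ℕ∞) S1 (OO m Ω) ∧ ContDiffOn ℝ (⊤ : ℕ∞) S2 (OO m Ω) ∧
      ∀ N z V γ, NrmD J ρ Ω k N z V γ →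
        fderiv ℝ ρ z (Dx^[m + 1] γ 0) = - S1 (jet m γ 0) ∧
        fderiv ℝ ρ z (J z (Dx^[m + 1] γ 0)) = - S2 (jet m γ 0) := by
  have hd := fd_rho hΩ hρ
  have hd2 : ContDiffOn ℝ (⊤ : ℕ∞) (fun q => (fderiv ℝ ρ q).comp (J q)) Ω :=
    hd.clm_comp (Jsmooth hJ).contDiffOn
  obtain ⟨S1, hS1, H1⟩ := leading hΩ hd m
  obtain ⟨S2, hS2, H2⟩ := leading hΩ hd2 m
  refine ⟨S1, S2, hS1, hS2, ?_⟩
  rintro N z V γ ⟨h1, h2, h3, h4, h5, h6⟩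
  have hf : ContDiffOn ℝ (⊤ : ℕ∞) (fun ζ => ρ (γ ζ)) V := hρ.comp h1.2.2.1 h2
  have a := van_Dxi h1.1 h1.2.1 hf h5 hm
  have b := van_DxiDy h1.1 h1.2.1 hf h5 hm
  rw [Function.iterate_succ_apply] at a
  have A := H1 V γ h1.1 h1.2.2.1 h2 (Dx (fun ζ => ρ (γ ζ)))
    (fun ζ hζ => chain h1.1 hΩ hρ h1.2.2.1 h2 hζ (1, 0)) h1.2.1
  have B := H2 V γ h1.1 h1.2.2.1 h2 (Dy (fun ζ => ρ (γ ζ)))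
    (fun ζ hζ => by
      refine (chain h1.1 hΩ hρ h1.2.2.1 h2 hζ (0, 1)).trans ?_
      exact congrArg (fderiv ℝ ρ (γ ζ)) (disk_Dy h1 hζ)) h1.2.1
  rw [a] at A
  rw [b] at B
  beta_reduce at A B
  rw [h3] at A B
  rw [ContinuousLinearMap.comp_apply] at B
  constructor <;> linarith

lemma jet_tendsto {𝒰 : Filter E4} {γ : E4 → E2 → E4} {l : ℕ → E4} {m : ℕ}
    (h : ∀ i ≤ m, Filter.Tendsto (fun z => Dx^[i] (γ z) 0) 𝒰 (𝓝 (l i))) :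
    Filter.Tendsto (fun z => jet m (γ z) 0) 𝒰 (𝓝 (fun i : Fin (m + 1) => l i)) :=
  tendsto_pi_nhds.2 fun i => h i (by omega)

lemma prod_tendsto {F G : Type} [NormedAddCommGroup F] [NormedSpace ℝ F] [NormedAddCommGroup G] [NormedSpace ℝ G]
    {𝒰 : Filter E4} {f : E4 → E4 →L[ℝ] F} {g : E4 → E4 →L[ℝ] G} {f0 : E4 →L[ℝ] F} {g0 : E4 →L[ℝ] G}
    (hf : Filter.Tendsto f 𝒰 (𝓝 f0)) (hg : Filter.Tendsto g 𝒰 (𝓝 g0)) :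
    Filter.Tendsto (fun z => (f z).prod (g z)) 𝒰 (𝓝 (f0.prod g0)) := by
  have hc : Continuous (fun q : (E4 →L[ℝ] F) × (E4 →L[ℝ] G) => q.1.prod q.2) :=
    LinearIsometryEquiv.continuous (ContinuousLinearMap.prodₗᵢ ℝ)
  exact (hc.tendsto (f0, g0)).comp (hf.prodMk_nhds hg)

lemma limits {J : E4 → E4 →L[ℝ] E4} (hJ : IsAlmostComplex J) {ρ : E4 → ℝ} {Ω : Set E4} (hΩ : IsOpen Ω)
    (hρ : ContDiffOn ℝ (⊤ : ℕ∞) ρ Ω) {k : ℕ} {p : E4} (hp : p ∈ Ω) (hdp : fderiv ℝ ρ p ≠ 0)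
    {𝒰 : Ultrafilter E4} (h𝒰 : (𝒰 : Filter E4) ≤ 𝓝 p) {V : E4 → Set E2} {γ : E4 → E2 → E4}
    (hN : ∀ᶠ z in (𝒰 : Filter E4), NrmD J ρ Ω k (k + 1) z (V z) (γ z)) :
    ∃ l : ℕ → E4, l 0 = p ∧ ‖l 1‖ = 1 ∧ ∀ m ≤ max k 1,
      Filter.Tendsto (fun z => Dx^[m] (γ z) 0) (𝒰 : Filter E4) (𝓝 (l m)) := by
  have hid : Filter.Tendsto (fun z : E4 => z) (𝒰 : Filter E4) (𝓝 p) := h𝒰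
  have t0 : Filter.Tendsto (fun z => Dx^[0] (γ z) 0) (𝒰 : Filter E4) (𝓝 p) := by
    refine hid.congr' ?_
    filter_upwards [hN] with z hz using hz.2.2.1.symm
  obtain ⟨h, hh, t1⟩ : ∃ h : E4, ‖h‖ = 1 ∧ Filter.Tendsto (fun z => Dx^[1] (γ z) 0) (𝒰 : Filter E4) (𝓝 h) := by
    have hc : IsCompact (Metric.sphere (0 : E4) 1) := isCompact_sphere 0 1
    obtain ⟨h, hh, ht⟩ := hc.ultrafilter_le_nhds (𝒰.map (fun z => Dx^[1] (γ z) 0)) (by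
      rw [Filter.le_principal_iff]
      change ∀ᶠ z in (𝒰 : Filter E4), Dx^[1] (γ z) 0 ∈ Metric.sphere (0 : E4) 1
      filter_upwards [hN] with z hz
      rw [mem_sphere_zero_iff_norm]
      exact hz.2.2.2.1)
    exact ⟨h, by simpa using hh, ht⟩
  have tJ : Filter.Tendsto J (𝒰 : Filter E4) (𝓝 (J p)) := ((Jsmooth hJ).continuous.tendsto p).comp hid
  have td : Filter.Tendsto (fderiv ℝ ρ) (𝒰 : Filter E4) (𝓝 (fderiv ℝ ρ p)) :=
    (((fd_rho hΩ hρ).continuousOn.continuousAt (hΩ.mem_nhds hp)).tendsto).comp hid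
  have hcont : Continuous (fun q : (E4 →L[ℝ] E4) × E4 => q.1 q.2) := continuous_fst.clm_apply continuous_snd
  have hcont2 : Continuous (fun q : (E4 →L[ℝ] ℝ) × E4 => q.1 q.2) := continuous_fst.clm_apply continuous_snd
  have hcont3 : Continuous (fun q : (E4 →L[ℝ] ℝ) × (E4 →L[ℝ] E4) => q.1.comp q.2) :=
    continuous_fst.clm_comp continuous_snd
  have tJ1 : Filter.Tendsto (fun z => J z (Dx^[1] (γ z) 0)) (𝒰 : Filter E4) (𝓝 (J p h)) :=
    (hcont.tendsto (J p, h)).comp (tJ.prodMk_nhds t1)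
  have step : ∀ m ≤ max k 1, ∃ y, Filter.Tendsto (fun z => Dx^[m] (γ z) 0) (𝒰 : Filter E4) (𝓝 y) := by
    intro m
    induction m using Nat.strong_induction_on with
    | _ m ih =>
      intro hm
      rcases Nat.lt_or_ge m 2 with hlt | hge
      · interval_cases m
        · exact ⟨_, t0⟩
        · exact ⟨_, t1⟩
      obtain ⟨n, rfl⟩ : ∃ n, m = n + 1 := ⟨m - 1, by omega⟩
      have hnk : n + 1 ≤ k := by omega
      have hk : 1 ≤ k := by omega
      obtain ⟨S1, S2, hS1, hS2, H⟩ := key hJ hΩ hρ hnk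
      have ih' : ∀ i, ∃ y, i ≤ n → Filter.Tendsto (fun z => Dx^[i] (γ z) 0) (𝒰 : Filter E4) (𝓝 y) := by
        intro i
        by_cases hi : i ≤ n
        · obtain ⟨y, hy⟩ := ih i (by omega) (by omega)
          exact ⟨y, fun _ => hy⟩
        · exact ⟨0, fun h => absurd h hi⟩
      choose l hl using ih'
      have hj := jet_tendsto hl
      have hl0 : l 0 = p := tendsto_nhds_unique (hl 0 (by omega)) t0
      have hmem : (fun i : Fin (n + 1) => l i) ∈ OO n Ω := by
        change l _ ∈ Ω
        simpa [hl0] using hp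
      have s1 := ((hS1.continuousOn.continuousAt ((OO_open n hΩ).mem_nhds hmem)).tendsto.comp hj).neg
      have s2 := ((hS2.continuousOn.continuousAt ((OO_open n hΩ).mem_nhds hmem)).tendsto.comp hj).neg
      have e1 : fderiv ℝ ρ p h = 0 := by
        have t := (hcont2.tendsto (fderiv ℝ ρ p, h)).comp (td.prodMk_nhds t1)
        refine tendsto_nhds_unique t (tendsto_const_nhds.congr' ?_)
        filter_upwards [hN] with z hz
        exact (key1 hΩ hρ hk hz).1.symm
      have e2 : fderiv ℝ ρ p (J p h) = 0 := by
        have t := (hcont2.tendsto (fderiv ℝ ρ p, J p h)).comp (td.prodMk_nhds tJ1)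
        refine tendsto_nhds_unique t (tendsto_const_nhds.congr' ?_)
        filter_upwards [hN] with z hz
        exact (key1 hΩ hρ hk hz).2.symm
      have tc : Filter.Tendsto (fun z => (fderiv ℝ ρ z).comp (J z)) (𝒰 : Filter E4) (𝓝 ((fderiv ℝ ρ p).comp (J p))) :=
        (hcont3.tendsto (fderiv ℝ ρ p, J p)).comp (td.prodMk_nhds tJ)
      have ti : Filter.Tendsto (fun z => innerSL ℝ (Dx^[1] (γ z) 0)) (𝒰 : Filter E4) (𝓝 (innerSL ℝ h)) :=
        ((innerSL ℝ (E := E4)).continuous.tendsto h).comp t1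
      have tiJ : Filter.Tendsto (fun z => innerSL ℝ (J z (Dx^[1] (γ z) 0))) (𝒰 : Filter E4) (𝓝 (innerSL ℝ (J p h))) :=
        ((innerSL ℝ (E := E4)).continuous.tendsto (J p h)).comp tJ1
      have tL := prod_tendsto td (prod_tendsto tc (prod_tendsto ti tiJ))
      refine tendsto_of_L tL ?_ (b := (_, _, 0, 0)) ((s1.prodMk_nhds (s2.prodMk_nhds
        ((tendsto_const_nhds (x := (0 : ℝ))).prodMk_nhds (tendsto_const_nhds (x := (0 : ℝ)))))).congr' ?_)
      · intro v hv
        have q1 : fderiv ℝ ρ p v = 0 := congrArg (fun x => x.1) hv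
        have q2 : fderiv ℝ ρ p (J p v) = 0 := congrArg (fun x => x.2.1) hv
        have q3 : inner ℝ h v = 0 := congrArg (fun x => x.2.2.1) hv
        have q4 : inner ℝ (J p h) v = 0 := congrArg (fun x => x.2.2.2) hv
        refine lin_alg (J p) (fun w => congrArg (fun f : E4 →L[ℝ] E4 => f w) (hJ.2 p)) _ hdp h ?_ e1 e2 v q1 q2 q3 q4
        intro h0
        rw [h0, norm_zero] at hh
        exact zero_ne_one hh
      · filter_upwards [hN] with z hz
        obtain ⟨a1, a2⟩ := H _ _ _ _ hz
        obtain ⟨a3, a4⟩ := hz.2.2.2.2.2 (n + 1) hge (by omega)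
        exact Prod.ext a1.symm (Prod.ext a2.symm (Prod.ext a3.symm a4.symm))
  have step' : ∀ m, ∃ y, m ≤ max k 1 → Filter.Tendsto (fun z => Dx^[m] (γ z) 0) (𝒰 : Filter E4) (𝓝 y) := by
    intro i
    by_cases hi : i ≤ max k 1
    · obtain ⟨y, hy⟩ := step i hi
      exact ⟨y, fun _ => hy⟩
    · exact ⟨0, fun h => absurd h hi⟩
  choose l hl using step'
  have hl0 : l 0 = p := tendsto_nhds_unique (hl 0 (by omega)) t0
  have hl1 : l 1 = h := tendsto_nhds_unique (hl 1 (by omega)) t1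
  exact ⟨l, hl0, by rw [hl1, hh], hl⟩

theorem main_aux
    (J : E4 → E4 →L[ℝ] E4) (ρ : E4 → ℝ) (Ω : Set E4)
    (hJ : IsAlmostComplex J) (hM : IsHypersurface ρ Ω) :
    ∀ p ∈ {x | x ∈ Ω ∧ ρ x = 0}, ∃ U : Set E4, IsOpen U ∧ p ∈ U ∧
      ∀ z ∈ U ∩ {x | x ∈ Ω ∧ ρ x = 0}, hypType J ρ z ≤ hypType J ρ p := by
  rintro p ⟨hp, hp0⟩
  obtain ⟨hΩ, han, hreg⟩ := hM
  have hρ : ContDiffOn ℝ (⊤ : ℕ∞) ρ Ω := fun x hx => (han x hx).contDiffAt.contDiffWithinAt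
  by_cases htop : hypType J ρ p = ⊤
  · exact ⟨univ, isOpen_univ, mem_univ _, fun z _ => by rw [htop]; exact le_top⟩
  have hne : {n : ℕ∞ | ∃ k : ℕ, n = (k : ℕ∞) ∧
      ∀ V γ, IsJHolDisk J V γ → IsRegularOn γ V → γ 0 = p →
        ¬ VanishesToOrder (fun z => ρ (γ z)) (k + 1)}.Nonempty := by
    by_contra hc
    rw [Set.not_nonempty_iff_eq_empty] at hc
    exact htop (by rw [hypType, hc, sInf_empty])
  obtain ⟨k, hk, hno⟩ := csInf_mem hne
  change hypType J ρ p = k at hk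
  let B : Set E4 := {z | z ∈ Ω ∧ ∃ V γ, IsJHolDisk J V γ ∧ IsRegularOn γ V ∧ γ 0 = z ∧
    VanishesToOrder (fun z => ρ (γ z)) (k + 1)}
  by_cases hB : p ∈ closure B
  · exfalso
    have : (𝓝[B] p).NeBot := mem_closure_iff_nhdsWithin_neBot.1 hB
    let 𝒰 : Ultrafilter E4 := Ultrafilter.of (𝓝[B] p)
    have h𝒰 : (𝒰 : Filter E4) ≤ 𝓝[B] p := Ultrafilter.of_le _
    have hex : ∀ z, ∃ V γ, z ∈ B → NrmD J ρ Ω k (k + 1) z V γ := by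
      intro z
      by_cases hz : z ∈ B
      · obtain ⟨hzΩ, V, γ, h1, h2, h3, h4⟩ := hz
        obtain ⟨V', γ', h⟩ := nrm_exists hΩ hρ hzΩ h1 h2 h3 h4 k
        exact ⟨V', γ', fun _ => h⟩
      · exact ⟨∅, 0, fun h => absurd h hz⟩
    choose V γ hVγ using hex
    have hN : ∀ᶠ z in (𝒰 : Filter E4), NrmD J ρ Ω k (k + 1) z (V z) (γ z) := by
      have : ∀ᶠ z in (𝒰 : Filter E4), z ∈ B := h𝒰 self_mem_nhdsWithin
      filter_upwards [this] with z hz using hVγ z hz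
    obtain ⟨l, l0, l1, hl⟩ := limits hJ hΩ hρ hp (hreg p hp hp0) (h𝒰.trans nhdsWithin_le_nhds) hN
    obtain ⟨W, u, hu, hjet⟩ := CK_jet hJ l (max k 1)
    have hu0 : u 0 = p := (hjet 0 (by omega)).trans l0
    have hu1 : Dx u 0 = l 1 := hjet 1 (by omega)
    have hu' := disk_into hu hΩ (by rw [hu0]; exact hp)
    obtain ⟨W', hW', hd, hr⟩ := disk_regular hu' (by
      rw [hu1]; intro h0; rw [h0, norm_zero] at l1; exact zero_ne_one l1)
    refine hno W' u hd hr hu0 ?_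
    intro i hi
    obtain ⟨Φ, hΦ, H⟩ := iterGood hJ hΩ hρ i
    have e := H W' u hd (fun x hx => (hW' hx).2) hd.2.1
    rw [e]
    have ej : jet i u 0 = fun a : Fin (i + 1) => l a := by
      funext a
      exact hjet a (by omega)
    beta_reduce
    rw [ej]
    have hmem : (fun a : Fin (i + 1) => l a) ∈ OO i Ω := by
      change l _ ∈ Ω
      simpa [l0] using hp
    have t := ((hΦ.continuousOn.continuousAt ((OO_open i hΩ).mem_nhds hmem)).tendsto.comp
      (jet_tendsto (fun a ha => hl a (by omega))))
    refine tendsto_nhds_unique t (tendsto_const_nhds.congr' ?_)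
    filter_upwards [hN] with z hz
    have e2 := H _ _ hz.1 hz.2.1 hz.1.2.1
    rw [hz.2.2.2.2.1 i hi] at e2
    exact e2
  · refine ⟨(closure B)ᶜ, isClosed_closure.isOpen_compl, hB, ?_⟩
    rintro z ⟨hz, hzΩ, hz0⟩
    rw [hk]
    refine sInf_le ⟨k, rfl, ?_⟩
    intro V γ h1 h2 h3 h4
    exact hz (subset_closure ⟨hzΩ, V, γ, h1, h2, h3, h4⟩)

end

/-- **Proposition 0-3.** The type function `z ↦ δ_M(z)` is upper semicontinuous on `M`. -/
theorem hypType_upperSemicontinuous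
    (J : E4 → E4 →L[ℝ] E4) (ρ : E4 → ℝ) (Ω : Set E4)
    (hJ : IsAlmostComplex J) (hM : IsHypersurface ρ Ω) :
    ∀ p ∈ {x | x ∈ Ω ∧ ρ x = 0}, ∃ U : Set E4, IsOpen U ∧ p ∈ U ∧
      ∀ z ∈ U ∩ {x | x ∈ Ω ∧ ρ x = 0}, hypType J ρ z ≤ hypType J ρ p := by
  exact main_aux J ρ Ω hJ hM
end
end

section
/- Let J be a real-analytic almost complex structure on ℝ⁴ and let M = {ρ = 0} be a germ of real-analytic hypersurface through 0, and suppose 0 is a point of infinite type. If u is a regular J-holomorphic disk with u(0) = 0 such that ρ∘u vanishes to order ≥ k+2 at 0, then there exists a regular J-holomorphic disk v with v(0) = 0 such that ρ∘v vanishes to order ≥ k+3 at 0 and all partial derivatives of u and v at 0 up to order k+1 coincide (u and v have the same (k+1)-jet at 0). -/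
noncomputable section

open Set

/-- A germ of real-analytic hypersurface through `0`: `M = {ρ = 0} ∩ Ω`. -/
def IsHypersurfaceGerm (ρ : E4 → ℝ) (Ω : Set E4) : Prop :=
  IsOpen Ω ∧ (0 : E4) ∈ Ω ∧ (∀ x ∈ Ω, AnalyticAt ℝ ρ x) ∧ ρ 0 = 0 ∧
    ∀ ζ ∈ Ω, ρ ζ = 0 → fderiv ℝ ρ ζ ≠ 0

/-- `p` is a point of infinite type for `M = {ρ = 0}`. -/
def InfiniteTypeAt (J : E4 → E4 →L[ℝ] E4) (ρ : E4 → ℝ) (p : E4) : Prop :=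
  ¬ ∃ k : ℕ, ∀ V γ, IsJHolDisk J V γ → IsRegularOn γ V → γ 0 = p →
      ¬ VanishesToOrder (fun z => ρ (γ z)) (k + 1)

open scoped Topology ContDiff
open Filter

def Van {F : Type} [NormedAddCommGroup F] [NormedSpace ℝ F] (n : ℕ) (f : E2 → F) : Prop :=
  ∀ i < n, iteratedFDeriv ℝ i f 0 = 0

section van
variable {F G H : Type} [NormedAddCommGroup F] [NormedSpace ℝ F]
  [NormedAddCommGroup G] [NormedSpace ℝ G] [NormedAddCommGroup H] [NormedSpace ℝ H]

theorem van_zero (f : E2 → F) : Van 0 f := by intro i hi; omega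

theorem Van.mono {m n : ℕ} {f : E2 → F} (h : Van n f) (hmn : m ≤ n) : Van m f :=
  fun i hi => h i (by omega)

theorem van_succ {n : ℕ} {f : E2 → F} :
    Van (n + 1) f ↔ f 0 = 0 ∧ Van n (fderiv ℝ f) := by
  have key : ∀ i, iteratedFDeriv ℝ (i + 1) f 0 = 0 ↔ iteratedFDeriv ℝ i (fderiv ℝ f) 0 = 0 := by
    intro i
    rw [← norm_eq_zero, ← norm_iteratedFDeriv_fderiv, norm_eq_zero]
  have key0 : iteratedFDeriv ℝ 0 f 0 = 0 ↔ f 0 = 0 := by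
    rw [← norm_eq_zero, norm_iteratedFDeriv_zero, norm_eq_zero]
  constructor
  · intro h
    exact ⟨key0.1 (h 0 (by omega)), fun i hi => (key i).1 (h (i + 1) (by omega))⟩
  · rintro ⟨h0, h⟩ i hi
    cases i with
    | zero => exact key0.2 h0
    | succ i => exact (key i).2 (h i (by omega))

theorem van_congr {n : ℕ} {f g : E2 → F} (h : f =ᶠ[𝓝 0] g) (hf : Van n f) : Van n g := by
  intro i hi
  rw [← hf i hi]
  exact ((h.iteratedFDeriv ℝ i).self_of_nhds).symm

theorem Van.add {n : ℕ} {f g : E2 → F} (hf : Van n f) (hg : Van n g)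
    (cf : ContDiffAt ℝ ∞ f 0) (cg : ContDiffAt ℝ ∞ g 0) : Van n (fun z => f z + g z) := by
  intro i hi
  have := iteratedFDeriv_add_apply (i := i) (cf.of_le (by exact_mod_cast le_top))
    (cg.of_le (by exact_mod_cast le_top))
  change iteratedFDeriv ℝ i (f + g) 0 = 0
  rw [this, hf i hi, hg i hi, add_zero]

theorem Van.clm {n : ℕ} {f : E2 → F} (hf : Van n f) (L : F →L[ℝ] G)
    (cf : ContDiffAt ℝ ∞ f 0) : Van n (fun z => L (f z)) := by
  intro i hi
  have := L.iteratedFDeriv_comp_left (i := i) (n := ∞) cf (by exact_mod_cast le_top)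
  change iteratedFDeriv ℝ i (L ∘ f) 0 = 0
  rw [this, hf i hi]
  ext; simp

theorem Van.neg {n : ℕ} {f : E2 → F} (hf : Van n f)
    (cf : ContDiffAt ℝ ∞ f 0) : Van n (fun z => - f z) := by
  simpa using hf.clm (-(ContinuousLinearMap.id ℝ F)) cf

theorem Van.sub {n : ℕ} {f g : E2 → F} (hf : Van n f) (hg : Van n g)
    (cf : ContDiffAt ℝ ∞ f 0) (cg : ContDiffAt ℝ ∞ g 0) : Van n (fun z => f z - g z) := by
  simpa [sub_eq_add_neg] using hf.add (hg.neg cg) cf cg.neg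

theorem ev_diff {f : G → F} {p : G} (cf : ContDiffAt ℝ ∞ f p) :
    ∀ᶠ z in 𝓝 p, DifferentiableAt ℝ f z := by
  have h1 : ContDiffAt ℝ 1 f p := cf.of_le (by exact_mod_cast le_top)
  filter_upwards [h1.eventually (by simp)] with z hz
  exact hz.differentiableAt (by simp)

theorem cfderiv {f : G → F} {p : G} (cf : ContDiffAt ℝ ∞ f p) :
    ContDiffAt ℝ ∞ (fderiv ℝ f) p := cf.fderiv_right (by simp)

end van

theorem Van.bilin : ∀ (N : ℕ) {F G H : Type} [NormedAddCommGroup F] [NormedSpace ℝ F]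
    [NormedAddCommGroup G] [NormedSpace ℝ G] [NormedAddCommGroup H] [NormedSpace ℝ H]
    (B : F →L[ℝ] G →L[ℝ] H) {m n : ℕ} {f : E2 → F} {g : E2 → G},
    m + n = N → Van m f → Van n g → ContDiffAt ℝ ∞ f 0 → ContDiffAt ℝ ∞ g 0 →
    Van N (fun z => B (f z) (g z)) := by
  intro N
  induction N with
  | zero => intros; exact van_zero _
  | succ N ih =>
    intro F G H _ _ _ _ _ _ B m n f g hmn hf hg cf cg
    rw [van_succ]
    constructor
    · rcases Nat.eq_zero_or_pos m with h | h
      · obtain ⟨n, rfl⟩ : ∃ n', n = n' + 1 := ⟨n - 1, by omega⟩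
        simp [(van_succ.1 hg).1]
      · obtain ⟨m, rfl⟩ : ∃ n', m = n' + 1 := ⟨m - 1, by omega⟩
        simp [(van_succ.1 hf).1]
    · have e : (fun z => B.precompR E2 (f z) (fderiv ℝ g z) +
          B.precompL E2 (fderiv ℝ f z) (g z)) =ᶠ[𝓝 0] fderiv ℝ (fun z => B (f z) (g z)) := by
        filter_upwards [ev_diff cf, ev_diff cg] with z h1 h2
        exact (B.hasFDerivAt_of_bilinear h1.hasFDerivAt h2.hasFDerivAt).fderiv.symm
      refine van_congr e ?_
      have hdf : Van (m - 1) (fderiv ℝ f) := by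
        cases m with
        | zero => exact van_zero _
        | succ m => exact (van_succ.1 hf).2
      have hdg : Van (n - 1) (fderiv ℝ g) := by
        cases n with
        | zero => exact van_zero _
        | succ m => exact (van_succ.1 hg).2
      refine Van.add ?_ ?_ ?_ ?_
      · exact ih (B.precompR E2) (m := N - (n - 1)) (n := n - 1) (by omega)
          (hf.mono (by omega)) hdg cf (cfderiv cg)
      · exact ih (B.precompL E2) (m := m - 1) (n := N - (m - 1)) (by omega)
          hdf (hg.mono (by omega)) (cfderiv cf) cg
      · exact ((B.precompR E2).contDiff.contDiffAt.comp (0 : E2) cf).clm_apply (cfderiv cg)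
      · exact ((B.precompL E2).contDiff.contDiffAt.comp (0 : E2) (cfderiv cf)).clm_apply cg

section van2
variable {F G H : Type} [NormedAddCommGroup F] [NormedSpace ℝ F]
  [NormedAddCommGroup G] [NormedSpace ℝ G] [NormedAddCommGroup H] [NormedSpace ℝ H]

/-- composition of operators -/
theorem Van.clm_comp {m n N : ℕ} {f : E2 → G →L[ℝ] H} {g : E2 → F →L[ℝ] G} (hN : m + n = N)
    (hf : Van m f) (hg : Van n g) (cf : ContDiffAt ℝ ∞ f 0) (cg : ContDiffAt ℝ ∞ g 0) :
    Van N (fun z => (f z).comp (g z)) :=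
  Van.bilin N (ContinuousLinearMap.compL ℝ F G H) hN hf hg cf cg

theorem Van.value {n : ℕ} {f : E2 → F} (h : Van n f) (hn : 1 ≤ n) : f 0 = 0 :=
  (van_succ.1 (h.mono hn : Van (0 + 1) f)).1

theorem Van.comp : ∀ (n : ℕ) {F : Type} [NormedAddCommGroup F] [NormedSpace ℝ F]
    {f : E2 → F} {φ : E2 → E2}, Van n f → ContDiffAt ℝ ∞ f 0 → ContDiffAt ℝ ∞ φ 0 → φ 0 = 0 →
    Van n (fun z => f (φ z)) := by
  intro n
  induction n with
  | zero => intros; exact van_zero _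
  | succ n ih =>
    intro F _ _ f φ hf cf cφ h0
    rw [van_succ] at hf ⊢
    refine ⟨by rw [h0]; exact hf.1, ?_⟩
    have cf' : ContDiffAt ℝ ∞ f (φ 0) := by rwa [h0]
    have e : (fun z => (fderiv ℝ f (φ z)).comp (fderiv ℝ φ z)) =ᶠ[𝓝 0]
        fderiv ℝ (fun z => f (φ z)) := by
      filter_upwards [ev_diff cφ, cφ.continuousAt.eventually (ev_diff cf')] with z h1 h2
      exact (h2.hasFDerivAt.comp z h1.hasFDerivAt).fderiv.symm
    refine van_congr e ?_
    exact Van.clm_comp (m := n) (n := 0) rfl (ih hf.2 (cfderiv cf) cφ h0) (van_zero _)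
      ((cfderiv cf').comp (0 : E2) cφ) (cfderiv cφ)

theorem Van.comp_sub : ∀ (n : ℕ) {F G : Type} [NormedAddCommGroup F] [NormedSpace ℝ F]
    [NormedAddCommGroup G] [NormedSpace ℝ G]
    {f : G → F} {u w : E2 → G}, Van n (fun z => u z - w z) → u 0 = w 0 →
    ContDiffAt ℝ ∞ f (w 0) → ContDiffAt ℝ ∞ u 0 → ContDiffAt ℝ ∞ w 0 →
    Van n (fun z => f (u z) - f (w z)) := by
  intro n
  induction n with
  | zero => intros; exact van_zero _
  | succ n ih =>
    intro F G _ _ _ _ f u w h h0 cf cu cw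
    rw [van_succ]
    refine ⟨by simp [h0], ?_⟩
    have cf' : ContDiffAt ℝ ∞ f (u 0) := by rwa [h0]
    have e : (fun z => (fderiv ℝ f (u z) - fderiv ℝ f (w z)).comp (fderiv ℝ u z) +
        (fderiv ℝ f (w z)).comp (fderiv ℝ (fun z => u z - w z) z)) =ᶠ[𝓝 0]
        fderiv ℝ (fun z => f (u z) - f (w z)) := by
      filter_upwards [ev_diff cu, ev_diff cw, cu.continuousAt.eventually (ev_diff cf'),
        cw.continuousAt.eventually (ev_diff cf)] with z h1 h2 h3 h4
      have a := ((h3.hasFDerivAt.comp z h1.hasFDerivAt).sub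
        (h4.hasFDerivAt.comp z h2.hasFDerivAt)).fderiv
      have b := (h1.hasFDerivAt.sub h2.hasFDerivAt).fderiv
      have b' : fderiv ℝ (fun z => u z - w z) z = fderiv ℝ u z - fderiv ℝ w z := b
      have a' : fderiv ℝ (fun z => f (u z) - f (w z)) z = _ := a
      rw [a', b']
      refine ContinuousLinearMap.ext fun v => ?_
      simp
    refine van_congr e ?_
    have k1 := (cfderiv cf').comp (0 : E2) cu
    have k2 := (cfderiv cf).comp (0 : E2) cw
    have k3 := cfderiv (cu.sub cw)
    refine Van.add ?_ ?_ ?_ ?_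
    · exact Van.clm_comp (m := n) (n := 0) rfl (ih (h.mono (by omega)) h0 (cfderiv cf) cu cw)
        (van_zero _) (k1.sub k2) (cfderiv cu)
    · exact Van.clm_comp (m := 0) (n := n) (by omega) (van_zero _) (van_succ.1 h).2 k2 k3
    · exact (k1.sub k2).clm_comp (cfderiv cu)
    · exact k2.clm_comp k3

theorem Van.comp_sub_lin {n : ℕ} (hn : 1 ≤ n)
    {f : G → F} {u w : E2 → G} (h : Van n (fun z => u z - w z)) (h0 : u 0 = w 0)
    (cf : ContDiffAt ℝ ∞ f (w 0)) (cu : ContDiffAt ℝ ∞ u 0) (cw : ContDiffAt ℝ ∞ w 0) :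
    Van (n + 1) (fun z => f (u z) - f (w z) - fderiv ℝ f (w 0) (u z - w z)) := by
  obtain ⟨n, rfl⟩ : ∃ n', n = n' + 1 := ⟨n - 1, by omega⟩
  rw [van_succ]
  refine ⟨by simp [h0], ?_⟩
  have cf' : ContDiffAt ℝ ∞ f (u 0) := by rwa [h0]
  have e : (fun z => (fderiv ℝ f (u z) - fderiv ℝ f (w z)).comp (fderiv ℝ u z) +
      (fderiv ℝ f (w z) - fderiv ℝ f (w 0)).comp (fderiv ℝ (fun z => u z - w z) z)) =ᶠ[𝓝 0]
      fderiv ℝ (fun z => f (u z) - f (w z) - fderiv ℝ f (w 0) (u z - w z)) := by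
    filter_upwards [ev_diff cu, ev_diff cw, cu.continuousAt.eventually (ev_diff cf'),
      cw.continuousAt.eventually (ev_diff cf)] with z h1 h2 h3 h4
    have a := (((h3.hasFDerivAt.comp z h1.hasFDerivAt).sub
      (h4.hasFDerivAt.comp z h2.hasFDerivAt)).sub
      ((fderiv ℝ f (w 0)).hasFDerivAt.comp z (h1.hasFDerivAt.sub h2.hasFDerivAt))).fderiv
    have b := (h1.hasFDerivAt.sub h2.hasFDerivAt).fderiv
    have b' : fderiv ℝ (fun z => u z - w z) z = fderiv ℝ u z - fderiv ℝ w z := b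
    have a' : fderiv ℝ (fun z => f (u z) - f (w z) - fderiv ℝ f (w 0) (u z - w z)) z = _ := a
    rw [a', b']
    refine ContinuousLinearMap.ext fun v => ?_
    simp
    abel
  refine van_congr e ?_
  have k1 := (cfderiv cf').comp (0 : E2) cu
  have k2 := (cfderiv cf).comp (0 : E2) cw
  have k3 := cfderiv (cu.sub cw)
  have k4 : ContDiffAt ℝ ∞ (fun z => fderiv ℝ f (w z) - fderiv ℝ f (w 0)) 0 :=
    k2.sub contDiffAt_const
  refine Van.add ?_ ?_ ?_ ?_
  · exact Van.clm_comp (m := n + 1) (n := 0) rfl (Van.comp_sub _ h h0 (cfderiv cf) cu cw)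
      (van_zero _) (k1.sub k2) (cfderiv cu)
  · refine Van.clm_comp (m := 1) (n := n) (by omega) ?_ (van_succ.1 h).2 k4 k3
    exact van_succ.2 ⟨by simp, van_zero _⟩
  · exact (k1.sub k2).clm_comp (cfderiv cu)
  · exact k4.clm_comp k3

end van2

def toC : E2 →L[ℝ] ℂ := Complex.equivRealProdCLM.symm.toContinuousLinearMap

theorem toC_apply (z : E2) : toC z = z.1 + z.2 * Complex.I := by
  exact Complex.equivRealProdCLM_symm_apply z

theorem toC_J0 (z : E2) : toC (J0 z) = Complex.I * toC z := by
  simp only [toC_apply, J0]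
  apply Complex.ext <;> simp

theorem J0_e : J0 (1, 0) = (0, 1) := by simp [J0]

def Phi (J1 : E4 →L[ℝ] E4) (a : E4) : ℂ →L[ℝ] E4 :=
  Complex.reCLM.smulRight a + Complex.imCLM.smulRight (J1 a)

theorem Phi_apply (J1 : E4 →L[ℝ] E4) (a : E4) (z : ℂ) :
    Phi J1 a z = z.re • a + z.im • J1 a := rfl

theorem Phi_I {J1 : E4 →L[ℝ] E4} (hJ : ∀ x, J1 (J1 x) = -x) (a : E4) (z : ℂ) :
    Phi J1 a (Complex.I * z) = J1 (Phi J1 a z) := by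
  simp [Phi_apply, hJ]
  abel

theorem hasFDerivAt_toC_pow (n : ℕ) (z : E2) :
    HasFDerivAt (fun z => toC z ^ (n + 1))
      (((ContinuousLinearMap.mul ℝ ℂ) (((n : ℂ) + 1) * toC z ^ n)).comp toC) z := by
  have h1 : HasDerivAt (fun w : ℂ => w ^ (n + 1)) (((n : ℂ) + 1) * toC z ^ n) (toC z) := by
    simpa using hasDerivAt_pow (n + 1) (toC z)
  have h2 := (h1.hasFDerivAt.restrictScalars ℝ).comp z toC.hasFDerivAt
  refine h2.congr_fderiv ?_
  refine ContinuousLinearMap.ext fun v => ?_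
  simp [mul_comm]

theorem contDiff_P {F : Type} [NormedAddCommGroup F] [NormedSpace ℝ F] (L : ℂ →L[ℝ] F) (n : ℕ) :
    ContDiff ℝ ∞ (fun z => L (toC z ^ n)) :=
  L.contDiff.comp (toC.contDiff.pow n)

theorem fderiv_P {F : Type} [NormedAddCommGroup F] [NormedSpace ℝ F] (L : ℂ →L[ℝ] F) (n : ℕ)
    (z v : E2) :
    fderiv ℝ (fun z => L (toC z ^ (n + 1))) z v = L (((n : ℂ) + 1) * toC z ^ n * toC v) := by
  have := (L.hasFDerivAt.comp z (hasFDerivAt_toC_pow n z)).fderiv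
  have h2 : fderiv ℝ (fun z => L (toC z ^ (n + 1))) z = _ := this
  rw [h2]; rfl

theorem P_inj (n : ℕ) : ∀ L : ℂ →L[ℝ] ℝ, Van (n + 1) (fun z => L (toC z ^ n)) → L 1 = 0 := by
  induction n with
  | zero => intro L h; simpa using h.value le_rfl
  | succ n ih =>
    intro L h
    have h1 := (van_succ.1 h).2.clm (ContinuousLinearMap.apply ℝ ℝ ((1, 0) : E2))
      (cfderiv (contDiff_P L _).contDiffAt)
    have h2 := ih (((n : ℝ) + 1) • L) (by
      convert h1 using 2 with z
      simp only [ContinuousLinearMap.apply_apply]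
      rw [fderiv_P, _root_.smul_apply, ← map_smul]
      congr 1
      simp [toC_apply])
    have h3 : (n : ℝ) + 1 ≠ 0 := by positivity
    simpa [h3] using h2

theorem P_inj' (n : ℕ) (L : ℂ →L[ℝ] ℝ) (h : Van (n + 2) (fun z => L (toC z ^ (n + 1)))) :
    L 1 = 0 ∧ L Complex.I = 0 := by
  refine ⟨P_inj _ L h, ?_⟩
  have h1 := (van_succ.1 h).2.clm (ContinuousLinearMap.apply ℝ ℝ ((0, 1) : E2))
      (cfderiv (contDiff_P L _).contDiffAt)
  have h2 := P_inj n (L.comp (ContinuousLinearMap.mul ℝ ℂ (((n : ℂ) + 1) * Complex.I))) (by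
      convert h1 using 2 with z
      simp only [ContinuousLinearMap.apply_apply]
      rw [fderiv_P, ContinuousLinearMap.comp_apply]
      congr 1
      simp [toC_apply]
      ring)
  have h3 : (n : ℝ) + 1 ≠ 0 := by positivity
  have h4 : L (((n : ℝ) + 1) • Complex.I) = 0 := by
    simpa using h2
  rw [map_smul] at h4
  simpa [h3] using h4

theorem lead {J1 : E4 →L[ℝ] E4} (hJ : ∀ x, J1 (J1 x) = -x) (n : ℕ) :
    ∀ g : E2 → E4, ContDiffAt ℝ ∞ g 0 → Van n g →
      Van n (fun z => (fderiv ℝ g z).comp J0 - J1.comp (fderiv ℝ g z)) →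
      ∃ a, Van (n + 1) (fun z => g z - Phi J1 a (toC z ^ n)) := by
  induction n with
  | zero =>
    intro g cg _ _
    exact ⟨g 0, van_succ.2 ⟨by simp [Phi_apply], van_zero _⟩⟩
  | succ n ih =>
    intro g cg hg hK
    have cdg := cfderiv cg
    have cK : ContDiffAt ℝ ∞ (fun z => (fderiv ℝ g z).comp J0 - J1.comp (fderiv ℝ g z)) 0 :=
      (cdg.clm_comp contDiffAt_const).sub (contDiffAt_const.clm_comp cdg)
    have ch : ContDiffAt ℝ ∞ (fun z => fderiv ℝ g z (1, 0)) 0 := cdg.clm_apply contDiffAt_const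
    have e : (fun z => fderiv ℝ (fun z => (fderiv ℝ g z).comp J0 - J1.comp (fderiv ℝ g z)) z (1, 0))
        =ᶠ[𝓝 0] (fun z => (fderiv ℝ (fun z => fderiv ℝ g z (1, 0)) z).comp J0 -
          J1.comp (fderiv ℝ (fun z => fderiv ℝ g z (1, 0)) z)) := by
      have c2 : ContDiffAt ℝ 2 g 0 := contDiffAt_infty.1 cg 2
      filter_upwards [ev_diff cdg, c2.eventually (by simp)] with z h1 h2
      have hs := h2.isSymmSndFDerivAt (by simp)
      have d1 : HasFDerivAt (fun z => fderiv ℝ g z (1, 0))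
          ((ContinuousLinearMap.apply ℝ E4 ((1, 0) : E2)).comp (fderiv ℝ (fderiv ℝ g) z)) z :=
        (ContinuousLinearMap.apply ℝ E4 ((1, 0) : E2)).hasFDerivAt.comp z h1.hasFDerivAt
      have d2 : HasFDerivAt (fun z => (fderiv ℝ g z).comp J0 - J1.comp (fderiv ℝ g z))
          ((((ContinuousLinearMap.compL ℝ E2 E2 E4).flip J0).comp (fderiv ℝ (fderiv ℝ g) z)) -
          ((ContinuousLinearMap.compL ℝ E2 E4 E4 J1).comp (fderiv ℝ (fderiv ℝ g) z))) z :=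
        (((ContinuousLinearMap.compL ℝ E2 E2 E4).flip J0).hasFDerivAt.comp z h1.hasFDerivAt).sub
        ((ContinuousLinearMap.compL ℝ E2 E4 E4 J1).hasFDerivAt.comp z h1.hasFDerivAt)
      rw [d1.fderiv, d2.fderiv]
      refine ContinuousLinearMap.ext fun v => ?_
      simp only [_root_.sub_apply, ContinuousLinearMap.comp_apply,
        ContinuousLinearMap.apply_apply, ContinuousLinearMap.flip_apply,
        ContinuousLinearMap.compL_apply]
      rw [hs (1, 0) (J0 v), hs (1, 0) v]
    have hKe := (van_succ.1 hK).2.clm (ContinuousLinearMap.apply ℝ (E2 →L[ℝ] E4) ((1, 0) : E2))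
      (cfderiv cK)
    have hh := (van_succ.1 hg).2.clm (ContinuousLinearMap.apply ℝ E4 ((1, 0) : E2)) cdg
    obtain ⟨a, ha⟩ := ih (fun z => fderiv ℝ g z (1, 0)) ch hh (van_congr e hKe)
    refine ⟨((n : ℝ) + 1)⁻¹ • a, ?_⟩
    have h3 : (n : ℝ) + 1 ≠ 0 := by positivity
    have hPhi : ∀ w : ℂ, Phi J1 (((n : ℝ) + 1)⁻¹ • a) (((n : ℂ) + 1) * w) = Phi J1 a w := by
      intro w
      have : ((n : ℂ) + 1) * w = ((n : ℝ) + 1) • w := by simp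
      have h5 : Phi J1 (((n : ℝ) + 1)⁻¹ • a) w = ((n : ℝ) + 1)⁻¹ • Phi J1 a w := by
        rw [Phi_apply, Phi_apply, map_smul, smul_add, smul_comm w.re, smul_comm w.im]
      rw [this, map_smul, h5, smul_inv_smul₀ h3]
    rw [van_succ]
    refine ⟨by simp [hg.value (by omega)], ?_⟩
    have cA : ContDiffAt ℝ ∞ (fun z => fderiv ℝ g z (1, 0) - Phi J1 a (toC z ^ n)) 0 :=
      ch.sub (contDiff_P _ _).contDiffAt
    have cKe : ContDiffAt ℝ ∞
      (fun z => ((fderiv ℝ g z).comp J0 - J1.comp (fderiv ℝ g z)) (1, 0)) 0 :=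
      cK.clm_apply contDiffAt_const
    have hB := (hK.clm (ContinuousLinearMap.apply ℝ E4 ((1, 0) : E2)) cK).add (ha.clm J1 cA)
      cKe (J1.contDiff.contDiffAt.comp (0 : E2) cA)
    have cB := cKe.add (J1.contDiff.contDiffAt.comp (0 : E2) cA)
    have hC := (ha.clm (ContinuousLinearMap.smulRightL ℝ E2 E4 (ContinuousLinearMap.fst ℝ ℝ ℝ)) cA).add
      (hB.clm (ContinuousLinearMap.smulRightL ℝ E2 E4 (ContinuousLinearMap.snd ℝ ℝ ℝ)) cB)
      ((ContinuousLinearMap.contDiff _).contDiffAt.comp (0 : E2) cA)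
      ((ContinuousLinearMap.contDiff _).contDiffAt.comp (0 : E2) cB)
    refine van_congr ?_ hC
    filter_upwards [ev_diff cg] with z h1
    have d : fderiv ℝ (fun z => g z - Phi J1 (((n : ℝ) + 1)⁻¹ • a) (toC z ^ (n + 1))) z =
      fderiv ℝ g z - fderiv ℝ (fun z => Phi J1 (((n : ℝ) + 1)⁻¹ • a) (toC z ^ (n + 1))) z :=
      fderiv_fun_sub h1 ((contDiff_P _ _).differentiable (by simp) z)
    rw [d]
    refine ContinuousLinearMap.ext fun v => ?_
    simp only [_root_.sub_apply, fderiv_P, mul_assoc, hPhi,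
      _root_.add_apply, ContinuousLinearMap.smulRightL_apply_apply,
      ContinuousLinearMap.apply_apply, ContinuousLinearMap.comp_apply, J0_e, map_sub]
    have hv : v = v.1 • ((1, 0) : E2) + v.2 • ((0, 1) : E2) := by ext <;> simp
    have ht : toC z ^ n * toC v = v.1 • (toC z ^ n) + v.2 • (Complex.I * toC z ^ n) := by
      simp [toC_apply v]; ring
    rw [ht, map_add, map_smul, map_smul, Phi_I hJ]
    conv_rhs => rw [hv, map_add, map_smul, map_smul]
    simp [smul_sub]
    abel

theorem lin_lemma {J1 : E4 →L[ℝ] E4} (hJ : ∀ x, J1 (J1 x) = -x) {l : E4 →L[ℝ] ℝ} (hl : l ≠ 0)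
    {a b : E4} (hb : b ≠ 0) (lb : l b = 0) (lJb : l (J1 b) = 0) (la : l a = 0)
    (lJa : l (J1 a) = 0) : ∃ c : ℂ, a = Phi J1 b c := by
  by_contra hc
  push Not at hc
  have key : LinearIndependent ℝ ![b, J1 b, a, J1 a] := by
    rw [Fintype.linearIndependent_iff]
    intro x hx
    simp only [Fin.sum_univ_four] at hx
    have hx' : x 0 • b + x 1 • J1 b + x 2 • a + x 3 • J1 a = 0 := by simpa using hx
    have hJx : x 0 • J1 b - x 1 • b + x 2 • J1 a - x 3 • a = 0 := by
      have := congrArg J1 hx'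
      simp [hJ] at this
      rw [← this]; abel
    by_cases h : x 2 ^ 2 + x 3 ^ 2 = 0
    · have h2 : x 2 = 0 := by nlinarith [sq_nonneg (x 2), sq_nonneg (x 3)]
      have h3 : x 3 = 0 := by nlinarith [sq_nonneg (x 2), sq_nonneg (x 3)]
      have hb2 : (x 0 ^ 2 + x 1 ^ 2) • b = 0 := by
        have : (x 0 ^ 2 + x 1 ^ 2) • b = x 0 • (x 0 • b + x 1 • J1 b + x 2 • a + x 3 • J1 a)
          - x 1 • (x 0 • J1 b - x 1 • b + x 2 • J1 a - x 3 • a) := by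
          rw [h2, h3]; module
        rw [this, hx', hJx]; simp
      have h01 := (smul_eq_zero.1 hb2).resolve_right hb
      have h0 : x 0 = 0 := by nlinarith [sq_nonneg (x 0), sq_nonneg (x 1)]
      have h1 : x 1 = 0 := by nlinarith [sq_nonneg (x 0), sq_nonneg (x 1)]
      intro i; fin_cases i <;> simp [h0, h1, h2, h3]
    · exfalso
      have ha2 : (x 2 ^ 2 + x 3 ^ 2) • a =
          (-(x 0 * x 2 + x 1 * x 3)) • b + (x 0 * x 3 - x 1 * x 2) • J1 b := by
        have : (x 2 ^ 2 + x 3 ^ 2) • a =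
          x 2 • (x 0 • b + x 1 • J1 b + x 2 • a + x 3 • J1 a)
          - x 3 • (x 0 • J1 b - x 1 • b + x 2 • J1 a - x 3 • a) +
          ((-(x 0 * x 2 + x 1 * x 3)) • b + (x 0 * x 3 - x 1 * x 2) • J1 b) := by
          module
        rw [this, hx', hJx]; simp
      refine hc ⟨(x 2 ^ 2 + x 3 ^ 2)⁻¹ * (-(x 0 * x 2 + x 1 * x 3)),
        (x 2 ^ 2 + x 3 ^ 2)⁻¹ * (x 0 * x 3 - x 1 * x 2)⟩ ?_
      rw [Phi_apply]
      simp only []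
      rw [mul_smul, mul_smul, ← smul_add, ← ha2, smul_smul, inv_mul_cancel₀ h, one_smul]
  have hspan := key.span_eq_top_of_card_eq_finrank (by simp)
  apply hl
  have : (l : E4 →ₗ[ℝ] ℝ) = 0 := by
    apply LinearMap.ext_on hspan
    rintro _ ⟨i, rfl⟩
    fin_cases i <;> simp [lb, lJb, la, lJa]
  ext x
  exact congrArg (fun f : E4 →ₗ[ℝ] ℝ => f x) this

theorem disk_smooth {J : E4 → E4 →L[ℝ] E4} {W : Set E2} {w : E2 → E4} (hw : IsJHolDisk J W w)
    {z : E2} (hz : z ∈ W) : ContDiffAt ℝ ∞ w z :=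
  hw.2.2.1.contDiffAt (hw.1.mem_nhds hz)

theorem step {J : E4 → E4 →L[ℝ] E4} {ρ : E4 → ℝ}
    (hJ : IsAlmostComplex J) (cρ : ContDiffAt ℝ ∞ ρ 0) (dρ : fderiv ℝ ρ 0 ≠ 0)
    {V : Set E2} {u : E2 → E4} (hu : IsJHolDisk J V u) (hu0 : u 0 = 0) (du : fderiv ℝ u 0 ≠ 0)
    {n K : ℕ} (hn : 1 ≤ n) (hK : n + 1 ≤ K) (hρu : Van (n + 1) (fun z => ρ (u z)))
    {W : Set E2} {w : E2 → E4} (hw : IsJHolDisk J W w) (hw0 : w 0 = 0) (dw : fderiv ℝ w 0 ≠ 0)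
    (hρw : Van K (fun z => ρ (w z))) (huw : Van n (fun z => u z - w z)) :
    ∃ W' w', IsJHolDisk J W' w' ∧ w' 0 = 0 ∧ fderiv ℝ w' 0 ≠ 0 ∧ Van K (fun z => ρ (w' z)) ∧
      Van (n + 1) (fun z => u z - w' z) := by
  have cu := disk_smooth hu hu.2.1
  have cw := disk_smooth hw hw.2.1
  have cJ : ContDiffAt ℝ ∞ J 0 := (hJ.1 0).contDiffAt
  have hJ1 : ∀ x, J 0 (J 0 x) = -x := fun x => by
    simpa using congrArg (fun f : E4 →L[ℝ] E4 => f x) (hJ.2 0)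
  have cuw := cu.sub cw
  -- the leading term
  obtain ⟨a, ha⟩ : ∃ a, Van (n + 1) (fun z => (u z - w z) - Phi (J 0) a (toC z ^ n)) := by
    refine lead hJ1 n _ cuw huw ?_
    have cJ' : ContDiffAt ℝ ∞ J (w 0) := by rwa [hw0]
    have cJ'' : ContDiffAt ℝ ∞ J (u 0) := by rwa [hu0]
    have k1 := cJ''.comp (0 : E2) cu
    have k2 := cJ'.comp (0 : E2) cw
    have k4 : ContDiffAt ℝ ∞ (fun z => J (w z) - J 0) 0 := k2.sub contDiffAt_const
    have h1 : Van n (fun z => (J (u z) - J (w z)).comp (fderiv ℝ u z)) :=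
      Van.clm_comp (m := n) (n := 0) rfl
        (Van.comp_sub n huw (by rw [hu0, hw0]) cJ' cu cw) (van_zero _) (k1.sub k2) (cfderiv cu)
    have h2 : Van n (fun z => (J (w z) - J 0).comp (fderiv ℝ (fun z => u z - w z) z)) := by
      obtain ⟨m, rfl⟩ : ∃ m, n = m + 1 := ⟨n - 1, by omega⟩
      exact Van.clm_comp (m := 1) (n := m) (by omega)
        (van_succ.2 ⟨by simp [hw0], van_zero _⟩) (van_succ.1 huw).2 k4 (cfderiv cuw)
    refine van_congr ?_ (h1.add h2 ((k1.sub k2).clm_comp (cfderiv cu)) (k4.clm_comp (cfderiv cuw)))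
    filter_upwards [hu.1.mem_nhds hu.2.1, hw.1.mem_nhds hw.2.1] with z h1 h2
    have d1 := (disk_smooth hu h1).differentiableAt (by simp)
    have d2 := (disk_smooth hw h2).differentiableAt (by simp)
    have b : fderiv ℝ (fun z => u z - w z) z = fderiv ℝ u z - fderiv ℝ w z :=
      fderiv_fun_sub d1 d2
    have b' : fderiv ℝ (u - w) z = fderiv ℝ u z - fderiv ℝ w z := b
    have e1 := hu.2.2.2 z h1
    have e2 := hw.2.2.2 z h2
    simp only [b, ContinuousLinearMap.sub_comp, ContinuousLinearMap.comp_sub, e1, e2]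
    abel
  -- tangency of w
  have cρ' : ContDiffAt ℝ ∞ ρ (w 0) := by rwa [hw0]
  have cρ'' : ContDiffAt ℝ ∞ ρ (u 0) := by rwa [hu0]
  have tw : ∀ v, fderiv ℝ ρ 0 (fderiv ℝ w 0 v) = 0 := by
    intro v
    have h1 := (van_succ.1 (hρw.mono (by omega : 1 + 1 ≤ K))).2.value le_rfl
    have h2 : fderiv ℝ (fun z => ρ (w z)) 0 = _ :=
      ((cρ'.differentiableAt (by simp)).hasFDerivAt.comp (0 : E2)
      (cw.differentiableAt (by simp)).hasFDerivAt).fderiv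
    rw [h1, hw0] at h2
    have := congrArg (fun f : E2 →L[ℝ] ℝ => f v) h2
    simpa using this.symm
  have hJw : ∀ v, fderiv ℝ w 0 (J0 v) = J 0 (fderiv ℝ w 0 v) := by
    intro v
    have := hw.2.2.2 0 hw.2.1
    rw [hw0] at this
    exact congrArg (fun f : E2 →L[ℝ] E4 => f v) this
  have hdw : ∀ v, fderiv ℝ w 0 v = Phi (J 0) (fderiv ℝ w 0 (1, 0)) (toC v) := by
    intro v
    have hv : v = v.1 • ((1, 0) : E2) + v.2 • (J0 (1, 0) : E2) := by
      rw [J0_e]; ext <;> simp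
    conv_lhs => rw [hv, map_add, map_smul, map_smul, hJw]
    rw [Phi_apply]
    simp [toC_apply]
  have hb : fderiv ℝ w 0 (1, 0) ≠ 0 := by
    intro h
    apply dw
    refine ContinuousLinearMap.ext fun v => ?_
    rw [hdw, h]; simp [Phi_apply]
  -- the leading term is tangent
  have hta : fderiv ℝ ρ 0 a = 0 ∧ fderiv ℝ ρ 0 (J 0 a) = 0 := by
    have h1 := Van.comp_sub_lin hn huw (by rw [hu0, hw0]) cρ' cu cw
    rw [hw0] at h1
    have c1 := cρ''.comp (0 : E2) cu
    have c2 := cρ'.comp (0 : E2) cw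
    have h2 := hρu.sub (hρw.mono hK) c1 c2
    have c3 := (fderiv ℝ ρ 0).contDiff.contDiffAt.comp (0 : E2) cuw
    have h3 := h2.sub h1 (c1.sub c2) ((c1.sub c2).sub c3)
    have c4 : ContDiffAt ℝ ∞ (fun z => (u z - w z) - Phi (J 0) a (toC z ^ n)) 0 :=
      cuw.sub (contDiff_P _ _).contDiffAt
    have h4 := h3.sub (ha.clm (fderiv ℝ ρ 0) c4)
      ((c1.sub c2).sub ((c1.sub c2).sub c3)) ((fderiv ℝ ρ 0).contDiff.contDiffAt.comp (0 : E2) c4)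
    have h5 : Van (n + 1) (fun z => ((fderiv ℝ ρ 0).comp (Phi (J 0) a)) (toC z ^ n)) := by
      refine van_congr (Eventually.of_forall fun z => ?_) h4
      simp
    obtain ⟨m, rfl⟩ : ∃ m, n = m + 1 := ⟨n - 1, by omega⟩
    simpa [Phi_apply] using P_inj' m _ h5
  obtain ⟨c, hc⟩ := lin_lemma hJ1 dρ hb (tw _) (by rw [← hJw]; exact tw _) hta.1 hta.2
  -- the reparametrization
  obtain ⟨ψ, hψ⟩ : ∃ ψ : ℂ →L[ℝ] E2, ∀ x, toC (ψ x) = x :=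
    ⟨Complex.equivRealProdCLM.toContinuousLinearMap, fun x => by
      apply Complex.ext <;> simp [toC]⟩
  have hinj : ∀ x y, toC x = toC y → x = y := by
    intro x y h
    exact Complex.equivRealProdCLM.symm.injective h
  let L : ℂ →L[ℝ] E2 := ψ.comp (ContinuousLinearMap.mul ℝ ℂ c)
  have hL : ∀ x, toC (L x) = c * x := fun x => hψ _
  let φ : E2 → E2 := fun z => z + L (toC z ^ n)
  have cφ : ContDiff ℝ ∞ φ := contDiff_id.add (contDiff_P L n)
  have φ0 : φ 0 = 0 := by
    have : n ≠ 0 := by omega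
    simp [φ, this]
  have hφJ : ∀ z v, fderiv ℝ φ z (J0 v) = J0 (fderiv ℝ φ z v) := by
    intro z v
    have d : fderiv ℝ φ z = ContinuousLinearMap.id ℝ E2 + fderiv ℝ (fun z => L (toC z ^ n)) z := by
      have := fderiv_fun_add (𝕜 := ℝ) (x := z) (differentiableAt_id (𝕜 := ℝ) (E := E2))
        ((contDiff_P L n).differentiable (by simp) z)
      simpa using this
    obtain ⟨m, rfl⟩ : ∃ m, n = m + 1 := ⟨n - 1, by omega⟩
    apply hinj
    rw [toC_J0, d]
    simp only [_root_.add_apply, fderiv_P, map_add, hL, toC_J0, ContinuousLinearMap.id_apply]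
    ring
  have cφ0 : ContDiffAt ℝ ∞ φ 0 := cφ.contDiffAt
  have hdisk : IsJHolDisk J (φ ⁻¹' W) (fun z => w (φ z)) := by
    refine ⟨hw.1.preimage cφ.continuous, by simpa [φ0] using hw.2.1,
      hw.2.2.1.comp cφ.contDiffOn (fun z hz => hz), ?_⟩
    intro z hz
    have d : fderiv ℝ (fun z => w (φ z)) z = (fderiv ℝ w (φ z)).comp (fderiv ℝ φ z) :=
      (((disk_smooth hw hz).differentiableAt (by simp)).hasFDerivAt.comp z
        (cφ.differentiable (by simp) z).hasFDerivAt).fderiv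
    rw [d]
    refine ContinuousLinearMap.ext fun v => ?_
    have := congrArg (fun f : E2 →L[ℝ] E4 => f (fderiv ℝ φ z v)) (hw.2.2.2 _ hz)
    simp only [ContinuousLinearMap.comp_apply] at this ⊢
    rw [hφJ, this]
  have hw0' : w (φ 0) = 0 := by rw [φ0, hw0]
  have cw' := disk_smooth hdisk hdisk.2.1
  have hVP : ∀ m, Van m (fun z => toC z ^ m) := by
    intro m
    induction m with
    | zero => exact van_zero _
    | succ m ih =>
      have h1 : Van 1 (fun z => toC z) := van_succ.2 ⟨by simp, van_zero _⟩
      have := Van.bilin (m + 1) (ContinuousLinearMap.mul ℝ ℂ) rfl ih h1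
        (toC.contDiff.pow m).contDiffAt toC.contDiff.contDiffAt
      simpa [pow_succ] using this
  have hfin : Van (n + 1) (fun z => u z - w (φ z)) := by
    have cid : ContDiffAt ℝ ∞ (fun z : E2 => z) 0 := contDiffAt_id
    have h1 : Van n (fun z => φ z - z) := by
      simpa [φ] using (hVP n).clm L (toC.contDiff.pow n).contDiffAt
    have h2 := Van.comp_sub_lin (w := fun z => z) hn h1 φ0 cw cφ0 cid
    have c4 : ContDiffAt ℝ ∞ (fun z => (u z - w z) - Phi (J 0) a (toC z ^ n)) 0 :=
      cuw.sub (contDiff_P _ _).contDiffAt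
    have h3 := ha.sub h2 c4 ((cw'.sub cw).sub
      ((fderiv ℝ w 0).contDiff.contDiffAt.comp (0 : E2) (cφ0.sub cid)))
    refine van_congr (Eventually.of_forall fun z => ?_) h3
    have : fderiv ℝ w 0 (φ z - z) = Phi (J 0) a (toC z ^ n) := by
      rw [hdw]
      have : toC (φ z - z) = c * toC z ^ n := by simp [φ, hL]
      rw [this, hc]
      have hJP : ∀ x y, J 0 (Phi (J 0) x y) = Phi (J 0) x (Complex.I * y) :=
        fun x y => (Phi_I hJ1 x y).symm
      rw [Phi_apply (J 0) (Phi (J 0) _ c), hJP, ← map_smul, ← map_smul, ← map_add]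
      congr 1
      conv_lhs => rw [← Complex.re_add_im (toC z ^ n)]
      simp only [Complex.real_smul]
      ring
    simp only [this]
    abel
  refine ⟨_, _, hdisk, hw0', ?_, ?_, hfin⟩
  · have h1 := (van_succ.1 (hfin.mono (by omega : 1 + 1 ≤ n + 1))).2.value le_rfl
    have h2 : fderiv ℝ (fun z => u z - w (φ z)) 0 = _ :=
      fderiv_fun_sub (cu.differentiableAt (by simp)) (cw'.differentiableAt (by simp))
    rw [h1] at h2
    rw [← sub_eq_zero.1 h2.symm]
    exact du
  · exact Van.comp K hρw (cρ'.comp (0 : E2) cw) cφ0 φ0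

/-- **Proposition 1-1 (prolongation of jets).** If `0` is of infinite type and `u` is a
regular `J`-holomorphic disk through `0` with contact of order `k+2` with `M`, then there
is a regular `J`-holomorphic disk `v` through `0` with contact of order `k+3` with `M` and
with the same `(k+1)`-jet at `0` as `u`. -/
theorem jet_prolongation_of_tangent_disk
    (J : E4 → E4 →L[ℝ] E4) (ρ : E4 → ℝ) (Ω : Set E4)
    (hJ : IsAlmostComplex J) (hM : IsHypersurfaceGerm ρ Ω)
    (h0 : InfiniteTypeAt J ρ 0) (k : ℕ) (V : Set E2) (u : E2 → E4)
    (hu : IsJHolDisk J V u) (hreg : IsRegularOn u V) (hu0 : u 0 = 0)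
    (htang : VanishesToOrder (fun z => ρ (u z)) (k + 2)) :
    ∃ W v, IsJHolDisk J W v ∧ IsRegularOn v W ∧ v 0 = 0 ∧
      VanishesToOrder (fun z => ρ (v z)) (k + 3) ∧
      ∀ i ≤ k + 1, iteratedFDeriv ℝ i u 0 = iteratedFDeriv ℝ i v 0 := by
  have cρ : ContDiffAt ℝ ∞ ρ 0 := (hM.2.2.1 0 hM.2.1).contDiffAt
  have dρ : fderiv ℝ ρ 0 ≠ 0 := hM.2.2.2.2 0 hM.2.1 hM.2.2.2.1
  have main : ∀ n ≤ k + 1, ∃ W w, IsJHolDisk J W w ∧ w 0 = 0 ∧ fderiv ℝ w 0 ≠ 0 ∧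
      Van (k + 3) (fun z => ρ (w z)) ∧ Van (n + 1) (fun z => u z - w z) := by
    intro n
    induction n with
    | zero =>
      intro _
      unfold InfiniteTypeAt at h0
      push Not at h0
      obtain ⟨W, w, hw, hr, hw0, hv⟩ := h0 (k + 2)
      exact ⟨W, w, hw, hw0, hr 0 hw.2.1, hv, van_succ.2 ⟨by simp [hu0, hw0], van_zero _⟩⟩
    | succ n ih =>
      intro hn
      obtain ⟨W, w, hw, hw0, hr, hv, huw⟩ := ih (by omega)
      have ht : Van (k + 2) (fun z => ρ (u z)) := htang
      exact step hJ cρ dρ hu hu0 (hreg 0 hu.2.1) (by omega) (by omega)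
        (ht.mono (by omega)) hw hw0 hr hv huw
  obtain ⟨W, w, hw, hw0, hr, hv, huw⟩ := main (k + 1) le_rfl
  have cw := disk_smooth hw hw.2.1
  have cu := disk_smooth hu hu.2.1
  have hcont : ContinuousOn (fderiv ℝ w) W :=
    hw.2.2.1.continuousOn_fderiv_of_isOpen hw.1 (by simp)
  refine ⟨W ∩ fderiv ℝ w ⁻¹' {0}ᶜ, w, ⟨?_, ⟨hw.2.1, hr⟩, hw.2.2.1.mono inter_subset_left,
    fun z hz => hw.2.2.2 z hz.1⟩, fun z hz => hz.2, hw0, hv, ?_⟩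
  · exact hcont.isOpen_inter_preimage hw.1 isOpen_compl_singleton
  · intro i hi
    have h1 := huw i (by omega)
    have h2 := iteratedFDeriv_sub_apply (i := i) (f := u) (g := w) (x := (0 : E2))
      (cu.of_le (by exact_mod_cast le_top)) (cw.of_le (by exact_mod_cast le_top))
    exact sub_eq_zero.1 (h2.symm.trans h1)
end
end
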